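/- arXiv:1107.0707 — 7 statements merged into one kernel-verified Lean document; each statement's English description precedes it below -/
import Mathlib

section
/- Let {μ_x : x ∈ ℝ^d} be a family of Borel probability measures on G = ℝ^{d×d} × ℝ^d such that α := sup_{x∈ℝ^d} ∫_G ‖m‖ dμ_x(m,q) < 1 and c := sup_{x∈ℝ^d} ∫_G |q| dμ_x(m,q) < ∞, the map x ↦ μ_x is Hölder continuous in the total variation norm, and there exists δ > 0 such that (μ_x ∧ μ_y)({(m,q) ∈ G : ‖m‖ ≤ α}) > δ for all x,y ∈ ℝ^d. Then the operator Pf(x) = ∫_G f(mx+q) dμ_x(m,q) possesses a unique invariant probability measure μ* on ℝ^d with ∫ |x| μ*(dx) < ∞, this measure is attractive among Borel probability measures on ℝ^d, and there exist q ∈ (0,1) and C > 0 such that ‖P^{*n}μ − μ*‖_FM ≤ q^n C (1 + ∫_{ℝ^d} |x| μ(dx)) for every probability measure μ on ℝ^d with finite first moment and every n ∈ ℕ. -/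
open MeasureTheory ProbabilityTheory Filter Set
open scoped ENNReal NNReal

noncomputable section

/-- The Fortet–Mourier distance between two Borel measures. -/
def fmDist {X : Type*} [MetricSpace X] [MeasurableSpace X] (μ ν : Measure X) : ℝ :=
  sSup {r : ℝ | ∃ f : X → ℝ, Continuous f ∧ (∀ x, |f x| ≤ 1) ∧
    (∀ x y, |f x - f y| ≤ dist x y) ∧ r = |∫ x, f x ∂μ - ∫ x, f x ∂ν|}

/-- The total variation norm `‖μ - ν‖` of the difference of two finite measures:
`|μ - ν|(univ) = sup_A ((μ A - ν A) - (μ Aᶜ - ν Aᶜ))`. -/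
def tvNorm {Θ : Type*} [MeasurableSpace Θ] (μ ν : Measure Θ) : ℝ :=
  sSup {r : ℝ | ∃ A : Set Θ, MeasurableSet A ∧
    r = ((μ A).toReal - (ν A).toReal) - ((μ Aᶜ).toReal - (ν Aᶜ).toReal)}

/-- Euclidean space ℝ^d. -/
abbrev Euc (d : ℕ) := EuclideanSpace ℝ (Fin d)

/-- `G = ℝ^{d×d} × ℝ^d`, with `ℝ^{d×d}` realized as the linear transformations of ℝ^d
(equipped with the operator norm `‖m‖ = sup{|mx| : |x| = 1}`). -/
abbrev MatVec (d : ℕ) := (Euc d →L[ℝ] Euc d) × Euc d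

/-- A bounded gauge function on `[0, ∞)` that is linear near zero, constant beyond `S`, and
strictly contracted both by a linear perturbation at small scales and by a jump `s ↦ a * s` of
probability `δ` at intermediate scales. -/
lemma exists_contracting_gauge {a δ L S : ℝ} (ha : 0 < a) (ha1 : a < 1) (hδ : 0 < δ)
    (hL : 0 ≤ L) (hS : 0 < S) :
    ∃ (φ : ℝ → ℝ) (k q c₀ : ℝ), Monotone φ ∧ (∀ t, 0 ≤ φ t) ∧ (∀ t, φ t ≤ 1) ∧
      0 < c₀ ∧ (∀ t, 0 ≤ t → c₀ * min 1 t ≤ φ t) ∧ 0 ≤ k ∧ (∀ t, 0 ≤ t → φ t ≤ k * t) ∧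
      0 < q ∧ q < 1 ∧ (∀ s, S ≤ s → φ s = 1) ∧
      ∀ s, 0 ≤ s → s < S →
        k * a * s + L * s ≤ q * φ s ∨ 1 - δ * (1 - φ (a * s)) ≤ q * φ s := by
  obtain ⟨p, hp1, hp⟩ : ∃ p : ℕ, 1 ≤ p ∧ a ^ p ≤ δ / 2 := by
    obtain ⟨n, hn⟩ := exists_pow_lt_of_lt_one (half_pos hδ) ha1
    exact ⟨n + 1, by omega, (pow_le_pow_of_le_one ha.le ha1.le (by omega)).trans hn.le⟩
  have hp0 : (0 : ℝ) < p := by exact_mod_cast hp1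
  have hap : 0 < a ^ p := pow_pos ha p
  obtain ⟨ε, hε, hεS, hεL⟩ : ∃ ε : ℝ, 0 < ε ∧ ε ≤ S ∧ L * ε ≤ (1 - a) / 4 := by
    refine ⟨min S ((1 - a) / (4 * (L + 1))), ?_, min_le_left _ _, ?_⟩
    · exact lt_min hS (div_pos (by linarith) (by linarith))
    · calc L * min S ((1 - a) / (4 * (L + 1))) ≤ (L + 1) * ((1 - a) / (4 * (L + 1))) := by
            gcongr
            · linarith
            · exact min_le_right _ _
        _ = (1 - a) / 4 := by field_simp
  obtain ⟨ξ, hξ, hξa, hξp⟩ : ∃ ξ : ℝ, 0 < ξ ∧ ξ ≤ (1 - a) / 4 ∧ ξ * p ≤ a ^ p := by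
    refine ⟨min ((1 - a) / 4) (a ^ p / p), lt_min (by linarith) (by positivity),
      min_le_left _ _, ?_⟩
    calc min ((1 - a) / 4) (a ^ p / p) * p ≤ a ^ p / p * p := by
          gcongr; exact min_le_right _ _
      _ = a ^ p := by field_simp
  set w : ℝ → ℝ := fun t => ξ / (1 + ξ) * (ε / t) ^ p with hw
  set φ : ℝ → ℝ := fun t =>
    if t < ε then max t 0 / (ε * (1 + ξ)) else if t < S then 1 - w t else 1 with hφ
  have w_pos : ∀ t, 0 < t → 0 < w t := fun t ht => by simp only [hw]; positivity
  have w_anti : ∀ s t, 0 < s → s ≤ t → w t ≤ w s := fun s t hs hst => by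
    simp only [hw]; have := hs.trans_le hst; gcongr
  have w_eps : w ε = ξ / (1 + ξ) := by simp [hw, hε.ne']
  have φ_small : ∀ t, t < ε → φ t = max t 0 / (ε * (1 + ξ)) := fun t ht => by simp [hφ, ht]
  have φ_mid : ∀ t, ε ≤ t → t < S → φ t = 1 - w t := fun t h1 h2 => by
    simp [hφ, h1.not_gt, h2]
  have φ_big : ∀ t, S ≤ t → φ t = 1 := fun t h2 => by
    simp [hφ, (hεS.trans h2).not_gt, h2.not_gt]
  have φ_small_le : ∀ t, t < ε → φ t ≤ 1 / (1 + ξ) := fun t ht => by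
    rw [φ_small t ht, div_le_div_iff₀ (by positivity) (by positivity)]
    have : max t 0 ≤ ε := max_le ht.le hε.le
    nlinarith
  have hone : 1 / (1 + ξ) = 1 - ξ / (1 + ξ) := by field_simp; ring
  have φ_ge : ∀ t, ε ≤ t → 1 / (1 + ξ) ≤ φ t := fun t ht => by
    rcases lt_or_ge t S with h | h
    · rw [φ_mid t ht h, hone]; have := w_anti ε t hε ht; rw [w_eps] at this; linarith
    · rw [φ_big t h, div_le_one (by positivity)]; linarith
  have φ_le1 : ∀ t, φ t ≤ 1 := fun t => by
    rcases lt_or_ge t ε with h | h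
    · refine (φ_small_le t h).trans ?_
      rw [div_le_one (by positivity)]; linarith
    rcases lt_or_ge t S with h' | h'
    · rw [φ_mid t h h']; have := w_pos t (hε.trans_le h); linarith
    · rw [φ_big t h']
  have φ_nonneg : ∀ t, 0 ≤ φ t := fun t => by
    rcases lt_or_ge t ε with h | h
    · rw [φ_small t h]; positivity
    · exact (by positivity : (0:ℝ) ≤ 1 / (1 + ξ)).trans (φ_ge t h)
  have φ_mono : Monotone φ := fun s t hst => by
    rcases lt_or_ge t ε with h | h
    · rw [φ_small t h, φ_small s (hst.trans_lt h)]; gcongr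
    rcases lt_or_ge s ε with h' | h'
    · exact (φ_small_le s h').trans (φ_ge t h)
    rcases lt_or_ge t S with h2 | h2
    · rw [φ_mid t h h2, φ_mid s h' (hst.trans_lt h2)]
      have := w_anti s t (hε.trans_le h') hst; linarith
    · rw [φ_big t h2]; exact φ_le1 s
  have wS : w S ≤ ξ / (1 + ξ) := w_eps ▸ w_anti ε S hε hεS
  have wS0 := w_pos S hS
  have hξ1 : ξ / (1 + ξ) < 1 := by rw [div_lt_one (by positivity)]; linarith
  refine ⟨φ, 1 / ε, max (1 - (1 - a) / 2) (1 - w S), min (1 / (1 + ξ)) (1 / (ε * (1 + ξ))),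
    φ_mono, φ_nonneg, φ_le1, lt_min (by positivity) (by positivity), ?_, by positivity, ?_,
    lt_max_of_lt_left (by linarith), max_lt (by linarith) (by linarith), φ_big, ?_⟩
  · intro t ht
    rcases lt_or_ge t ε with h | h
    · rw [φ_small t h, max_eq_left ht]
      calc min (1 / (1 + ξ)) (1 / (ε * (1 + ξ))) * min 1 t ≤ 1 / (ε * (1 + ξ)) * t := by
            gcongr
            · exact min_le_right _ _
            · exact min_le_right _ _
        _ = _ := by ring
    · refine le_trans ?_ (φ_ge t h)
      calc min (1 / (1 + ξ)) (1 / (ε * (1 + ξ))) * min 1 t ≤ 1 / (1 + ξ) * 1 := by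
            gcongr
            · exact min_le_left _ _
            · exact min_le_left _ _
        _ = _ := by ring
  · intro t ht
    rcases lt_or_ge t ε with h | h
    · rw [φ_small t h, max_eq_left ht, div_mul_eq_mul_div, one_mul]
      gcongr
      nlinarith
    · refine (φ_le1 t).trans ?_
      rw [div_mul_eq_mul_div, one_mul, one_le_div hε]; exact h
  · intro s hs hsS
    rcases lt_or_ge s ε with h | h
    · left
      refine le_trans ?_ (mul_le_mul_of_nonneg_right (le_max_left _ _) (φ_nonneg s))
      rw [φ_small s h, max_eq_left hs]
      have key : (a + L * ε) * (1 + ξ) ≤ 1 - (1 - a) / 2 := by nlinarith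
      calc 1 / ε * a * s + L * s = (a + L * ε) * (1 + ξ) * (s / (ε * (1 + ξ))) := by
            field_simp
        _ ≤ _ := by gcongr
    · right
      refine le_trans ?_ (mul_le_mul_of_nonneg_right (le_max_right _ _) (φ_nonneg s))
      have hs0 : 0 < s := hε.trans_le h
      have has : 0 < a * s := mul_pos ha hs0
      have hws : w s = a ^ p * w (a * s) := by
        simp only [hw]
        rw [mul_left_comm, ← mul_pow]
        congr 2
        field_simp
      have hlow : w (a * s) ≤ 1 - φ (a * s) := by
        rcases lt_or_ge (a * s) ε with h1 | h1
        · rw [φ_small _ h1, max_eq_left has.le]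
          set z := a * s / ε with hz
          have hz0 : 0 < z := by positivity
          have hz1 : z < 1 := by rw [hz, div_lt_one hε]; exact h1
          have haz : a ≤ z := by rw [hz, le_div_iff₀ hε]; gcongr
          have hwz : w (a * s) = ξ / (1 + ξ) * (1 / z ^ p) := by
            simp only [hw, hz]; rw [← one_div_pow, one_div_div]
          have hb : 1 - z ^ p ≤ p * (1 - z) := by
            have := one_add_mul_le_pow (a := z - 1) (by linarith) p
            rw [show 1 + (z - 1) = z by ring] at this
            nlinarith
          have hzp : a ^ p ≤ z ^ p := by gcongr
          have hmain : ξ ≤ (1 + ξ - z) * z ^ p := by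
            have h1 : ξ * (1 - z ^ p) ≤ ξ * (p * (1 - z)) := by gcongr
            have h2 : ξ * p * (1 - z) ≤ z ^ p * (1 - z) :=
              mul_le_mul_of_nonneg_right (hξp.trans hzp) (by linarith)
            nlinarith
          have e1 : 1 - a * s / (ε * (1 + ξ)) = (1 + ξ - z) / (1 + ξ) := by
            rw [hz]; field_simp
          rw [hwz, e1, div_mul_div_comm, div_le_div_iff₀ (by positivity) (by positivity)]
          nlinarith
        · rw [φ_mid _ h1 ((mul_le_of_le_one_left hs0.le ha1.le).trans_lt hsS)]; linarith
      have hw2 : 2 * w s ≤ δ * (1 - φ (a * s)) := by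
        have := w_pos _ has
        calc 2 * w s = 2 * a ^ p * w (a * s) := by rw [hws]; ring
          _ ≤ δ * w (a * s) := by gcongr; linarith
          _ ≤ _ := by gcongr
      have hwS : w S ≤ w s := w_anti s S hs0 hsS.le
      rw [φ_mid s h hsS]
      have := w_pos s hs0
      nlinarith

/-- Two images of probability measures can be coupled so that the common part `θ` moves along the
same randomness. -/
lemma exists_coupling_of_common_part {Ω E : Type*} [MeasurableSpace Ω] [MeasurableSpace E]
    {μ ν θ : Measure Ω} [IsProbabilityMeasure μ] [IsProbabilityMeasure ν]
    (hμ : θ ≤ μ) (hν : θ ≤ ν) {F G : Ω → E} (hF : Measurable F) (hG : Measurable G) :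
    ∃ π : Measure (E × E), IsProbabilityMeasure π ∧ π.map Prod.fst = μ.map F ∧
      π.map Prod.snd = ν.map G ∧
      ∀ h : E × E → ℝ≥0∞, Measurable h → (∀ z, h z ≤ 1) →
        ∫⁻ z, h z ∂π ≤ ∫⁻ g, h (F g, G g) ∂θ + (1 - θ univ) := by
  have : IsFiniteMeasure θ := isFiniteMeasure_of_le μ hμ
  set κ : ℝ≥0∞ := 1 - θ univ with hκ
  have e1 : (μ - θ) univ = κ := by rw [Measure.sub_apply .univ hμ, measure_univ]
  have e2 : (ν - θ) univ = κ := by rw [Measure.sub_apply .univ hν, measure_univ]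
  have hκt : κ ≠ ∞ := (tsub_le_self.trans_lt ENNReal.one_lt_top).ne
  have hFG : Measurable fun g => (F g, G g) := hF.prodMk hG
  set π : Measure (E × E) := θ.map (fun g => (F g, G g)) +
    κ⁻¹ • (((μ - θ).map F).prod ((ν - θ).map G)) with hπ
  have h1 : π.map Prod.fst = μ.map F := by
    rw [hπ, Measure.map_add _ _ measurable_fst, Measure.map_map measurable_fst hFG,
      Measure.map_smul, Measure.map_fst_prod, Measure.map_apply hG .univ, preimage_univ, e2]
    have : κ⁻¹ • κ • (μ - θ).map F = (μ - θ).map F := by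
      by_cases h0 : κ = 0
      · rw [h0] at e1; rw [Measure.measure_univ_eq_zero.1 e1]; simp
      · rw [smul_smul, ENNReal.inv_mul_cancel h0 hκt, one_smul]
    rw [this]
    conv_rhs => rw [← Measure.sub_add_cancel_of_le hμ, Measure.map_add _ _ hF]
    rw [add_comm]; rfl
  have h2 : π.map Prod.snd = ν.map G := by
    rw [hπ, Measure.map_add _ _ measurable_snd, Measure.map_map measurable_snd hFG,
      Measure.map_smul, Measure.map_snd_prod, Measure.map_apply hF .univ, preimage_univ, e1]
    have : κ⁻¹ • κ • (ν - θ).map G = (ν - θ).map G := by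
      by_cases h0 : κ = 0
      · rw [h0] at e2; rw [Measure.measure_univ_eq_zero.1 e2]; simp
      · rw [smul_smul, ENNReal.inv_mul_cancel h0 hκt, one_smul]
    rw [this]
    conv_rhs => rw [← Measure.sub_add_cancel_of_le hν, Measure.map_add _ _ hG]
    rw [add_comm]; rfl
  refine ⟨π, ⟨?_⟩, h1, h2, fun h hh hle => ?_⟩
  · have := congrArg (fun m => m univ) h1
    simpa [Measure.map_apply measurable_fst, Measure.map_apply hF] using this
  · rw [hπ, lintegral_add_measure, lintegral_map hh hFG, lintegral_smul_measure]
    gcongr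
    calc κ⁻¹ • ∫⁻ z, h z ∂(((μ - θ).map F).prod ((ν - θ).map G))
        ≤ κ⁻¹ • ∫⁻ _, 1 ∂(((μ - θ).map F).prod ((ν - θ).map G)) := by
          rw [smul_eq_mul, smul_eq_mul]; gcongr; exact hle _
      _ = κ⁻¹ * (κ * κ) := by
          rw [lintegral_one, ← univ_prod_univ, Measure.prod_prod, Measure.map_apply hF .univ,
            Measure.map_apply hG .univ, preimage_univ, preimage_univ, e1, e2, smul_eq_mul]
      _ ≤ κ := by
          rw [← mul_assoc]
          exact mul_le_of_le_one_left zero_le (ENNReal.inv_mul_le_one _)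

/-- The measures of a set under two probability measures differ at most by the total variation
norm of the difference. -/
lemma real_sub_le_tvNorm {Ω : Type*} [MeasurableSpace Ω] (μ ν : Measure Ω)
    [IsProbabilityMeasure μ] [IsProbabilityMeasure ν] {A : Set Ω} (hA : MeasurableSet A) :
    2 * (μ.real A - ν.real A) ≤ tvNorm μ ν := by
  have hb : BddAbove {r : ℝ | ∃ A : Set Ω, MeasurableSet A ∧
      r = ((μ A).toReal - (ν A).toReal) - ((μ Aᶜ).toReal - (ν Aᶜ).toReal)} := by
    refine ⟨2, ?_⟩
    rintro r ⟨B, -, rfl⟩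
    have h1 : μ.real B ≤ 1 := measureReal_le_one
    have h2 : ν.real Bᶜ ≤ 1 := measureReal_le_one
    have h3 : 0 ≤ ν.real B := measureReal_nonneg
    have h4 : 0 ≤ μ.real Bᶜ := measureReal_nonneg
    simp only [Measure.real] at h1 h2 h3 h4
    linarith
  refine le_trans (le_of_eq ?_) (le_csSup hb ⟨A, hA, rfl⟩)
  have h1 := probReal_compl_eq_one_sub (μ := μ) hA
  have h2 := probReal_compl_eq_one_sub (μ := ν) hA
  simp only [Measure.real] at h1 h2 ⊢
  rw [h1, h2]; ring

/-- The mass lost when passing from a probability measure to its infimum with another one is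
controlled by the total variation norm of the difference. -/
lemma one_sub_inf_univ_le_tvNorm {Ω : Type*} [MeasurableSpace Ω] (μ ν : Measure Ω)
    [IsProbabilityMeasure μ] [IsProbabilityMeasure ν] :
    1 - (μ ⊓ ν) univ ≤ ENNReal.ofReal (tvNorm μ ν) := by
  obtain ⟨s, hs, h1, h2⟩ := hahn_decomposition μ ν
  have le_of : ∀ {m m' : Measure Ω} {t : Set Ω}, MeasurableSet t →
      (∀ u, MeasurableSet u → u ⊆ t → m u ≤ m' u) → m.restrict t ≤ m'.restrict t := by
    intro m m' t ht h
    refine Measure.le_iff.2 fun u hu => ?_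
    rw [Measure.restrict_apply hu, Measure.restrict_apply hu]
    exact h _ (hu.inter ht) inter_subset_right
  set σ : Measure Ω := ν.restrict s + μ.restrict sᶜ with hσ
  have hσμ : σ ≤ μ := by
    calc σ ≤ μ.restrict s + μ.restrict sᶜ := by
          rw [hσ]; exact add_le_add (le_of hs h1) le_rfl
      _ = μ := Measure.restrict_add_restrict_compl hs
  have hσν : σ ≤ ν := by
    calc σ ≤ ν.restrict s + ν.restrict sᶜ := by
          rw [hσ]; exact add_le_add le_rfl (le_of hs.compl h2)
      _ = ν := Measure.restrict_add_restrict_compl hs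
  have hle : σ univ ≤ (μ ⊓ ν) univ := (le_inf hσμ hσν) univ
  have hσu : σ univ = ν s + μ sᶜ := by simp [hσ]
  have h3 := real_sub_le_tvNorm μ ν hs
  have h4 : ν.real s ≤ μ.real s := ENNReal.toReal_mono (measure_ne_top _ _) (h1 s hs subset_rfl)
  calc 1 - (μ ⊓ ν) univ ≤ 1 - σ univ := tsub_le_tsub_left hle 1
    _ = ENNReal.ofReal (1 - (ν.real s + μ.real sᶜ)) := by
        rw [hσu, ENNReal.ofReal_sub _ (by positivity), ENNReal.ofReal_one,
          ENNReal.ofReal_add (by positivity) (by positivity), ofReal_measureReal,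
          ofReal_measureReal]
    _ ≤ ENNReal.ofReal (tvNorm μ ν) := by
        refine ENNReal.ofReal_le_ofReal ?_
        rw [probReal_compl_eq_one_sub hs]
        linarith

/-- Cauchy–Schwarz estimate for the difference of the integrals of a function against the two
marginals of a coupling. -/
lemma abs_integral_fst_sub_snd_le {E : Type*} [MeasurableSpace E] (π : Measure (E × E))
    {f : E → ℝ} {X Y : E × E → ℝ} {K A B : ℝ}
    (hX : Integrable X π) (hY : Integrable Y π) (hX0 : ∀ z, 0 ≤ X z) (hY0 : ∀ z, 0 ≤ Y z)
    (hK : 0 ≤ K) (h : ∀ z, |f z.1 - f z.2| ≤ K * √(X z * Y z))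
    (hA : 0 < A) (hB : 0 < B) (hXA : ∫ z, X z ∂π ≤ A) (hYB : ∫ z, Y z ∂π ≤ B) :
    |∫ z, (f z.1 - f z.2) ∂π| ≤ K * √(A * B) := by
  have hsA : 0 < √A := Real.sqrt_pos.2 hA
  have hsB : 0 < √B := Real.sqrt_pos.2 hB
  have amgm : ∀ z, |f z.1 - f z.2| ≤ K * ((√B / √A * X z + √A / √B * Y z) / 2) := fun z => by
    refine (h z).trans ?_
    gcongr
    refine Real.sqrt_le_iff.2 ⟨?_, ?_⟩
    · have := hX0 z; have := hY0 z; positivity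
    · have e : (√B / √A * X z) * (√A / √B * Y z) = X z * Y z := by field_simp
      rw [← e]
      nlinarith [sq_nonneg (√B / √A * X z - √A / √B * Y z)]
  calc |∫ z, (f z.1 - f z.2) ∂π| ≤ ∫ z, |f z.1 - f z.2| ∂π := abs_integral_le_integral_abs
    _ ≤ ∫ z, K * ((√B / √A * X z + √A / √B * Y z) / 2) ∂π := by
        refine integral_mono_of_nonneg (.of_forall fun z => abs_nonneg _) ?_ (.of_forall amgm)
        exact (((hX.const_mul _).add (hY.const_mul _)).div_const _).const_mul _
    _ = K * ((√B / √A * ∫ z, X z ∂π + √A / √B * ∫ z, Y z ∂π) / 2) := by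
        rw [integral_const_mul, integral_div,
          integral_add (hX.const_mul _) (hY.const_mul _), integral_const_mul,
          integral_const_mul]
    _ ≤ K * ((√B / √A * A + √A / √B * B) / 2) := by gcongr
    _ = K * √(A * B) := by
        rw [Real.sqrt_mul hA.le]
        have h1 : √B / √A * A = √A * √B := by
          nth_rewrite 2 [← Real.mul_self_sqrt hA.le]; field_simp
        have h2 : √A / √B * B = √A * √B := by
          nth_rewrite 2 [← Real.mul_self_sqrt hB.le]; field_simp
        rw [h1, h2]; ring

section MarkovOperator

variable {E : Type*} [MeasurableSpace E]

/-- The Markov operator `f ↦ ∫ f dκ(x, ·)` on real functions. -/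
def markovOp (κ : Kernel E E) (f : E → ℝ) (x : E) : ℝ := ∫ y, f y ∂κ x

variable {κ : Kernel E E} [IsMarkovKernel κ] {f : E → ℝ} {M : ℝ}

omit [IsMarkovKernel κ] in
lemma Measurable.markovOp_iterate (hf : Measurable f) (n : ℕ) :
    Measurable ((markovOp κ)^[n] f) := by
  induction n with
  | zero => exact hf
  | succ n ih =>
    rw [Function.iterate_succ_apply']
    exact ih.stronglyMeasurable.integral_kernel.measurable

lemma abs_markovOp_iterate_le (hM : ∀ x, |f x| ≤ M) (n : ℕ) (x : E) :
    |(markovOp κ)^[n] f x| ≤ M := by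
  induction n generalizing x with
  | zero => exact hM x
  | succ n ih =>
    rw [Function.iterate_succ_apply']
    simpa [markovOp] using norm_integral_le_of_norm_le_const (μ := κ x)
      (f := (markovOp κ)^[n] f) (.of_forall fun y => ih y)

lemma integrable_of_measurable_of_abs_le (hf : Measurable f) (hM : ∀ x, |f x| ≤ M)
    (μ : Measure E) [IsFiniteMeasure μ] : Integrable f μ :=
  .of_bound hf.aestronglyMeasurable M (.of_forall hM)

lemma isProbabilityMeasure_bind_iterate (μ : Measure E) [IsProbabilityMeasure μ] (n : ℕ) :
    IsProbabilityMeasure ((fun m : Measure E => m.bind κ)^[n] μ) := by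
  induction n with
  | zero => assumption
  | succ n ih =>
    rw [Function.iterate_succ_apply']
    infer_instance

lemma integral_bind_kernel (hf : Measurable f) (hM : ∀ x, |f x| ≤ M) (μ : Measure E)
    [IsProbabilityMeasure μ] : ∫ x, f x ∂(μ.bind κ) = ∫ x, markovOp κ f x ∂μ := by
  rw [← Measure.snd_compProd, Measure.snd,
    integral_map measurable_snd.aemeasurable hf.aestronglyMeasurable, Measure.integral_compProd]
  · rfl
  · exact integrable_of_measurable_of_abs_le (hf.comp measurable_snd) (fun z => hM z.2) _

lemma integral_bind_iterate (hf : Measurable f) (hM : ∀ x, |f x| ≤ M) (μ : Measure E)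
    [IsProbabilityMeasure μ] (n : ℕ) :
    ∫ x, f x ∂((fun m : Measure E => m.bind κ)^[n] μ) = ∫ x, (markovOp κ)^[n] f x ∂μ := by
  induction n generalizing μ with
  | zero => rfl
  | succ n ih =>
    rw [Function.iterate_succ_apply, ih, Function.iterate_succ_apply',
      integral_bind_kernel (hf.markovOp_iterate n) (abs_markovOp_iterate_le hM n)]

lemma markovOp_iterate_sub_le {D : E → E → ℝ} {q : ℝ} (hq : 0 ≤ q)
    (hD : ∀ f : E → ℝ, Measurable f → (∃ M, ∀ x, |f x| ≤ M) → ∀ K, 0 ≤ K →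
      (∀ x y, |f x - f y| ≤ K * D x y) →
      ∀ x y, |markovOp κ f x - markovOp κ f y| ≤ K * q * D x y)
    {K : ℝ} (hK : 0 ≤ K) (hf : Measurable f) (hM : ∀ x, |f x| ≤ M)
    (hfK : ∀ x y, |f x - f y| ≤ K * D x y) (n : ℕ) (x y : E) :
    |(markovOp κ)^[n] f x - (markovOp κ)^[n] f y| ≤ K * q ^ n * D x y := by
  induction n generalizing x y with
  | zero => simpa using hfK x y
  | succ n ih =>
    rw [Function.iterate_succ_apply', pow_succ, ← mul_assoc]
    exact hD _ (hf.markovOp_iterate n) ⟨M, abs_markovOp_iterate_le hM n⟩ _ (by positivity) ih x y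

variable [NormedAddCommGroup E] [BorelSpace E]

omit [IsMarkovKernel κ] in
lemma lintegral_norm_bind_iterate_le {α c m : ℝ} (hα0 : 0 ≤ α) (hm : 0 ≤ m) (hc : 0 ≤ c)
    (hmc : α * m + c ≤ m)
    (hmom : ∀ x, ∫⁻ y, ENNReal.ofReal ‖y‖ ∂κ x ≤
      ENNReal.ofReal α * ENNReal.ofReal ‖x‖ + ENNReal.ofReal c)
    (μ : Measure E) [IsMarkovKernel κ] [IsProbabilityMeasure μ]
    (hμ : ∫⁻ x, ENNReal.ofReal ‖x‖ ∂μ ≤ ENNReal.ofReal m) (n : ℕ) :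
    ∫⁻ x, ENNReal.ofReal ‖x‖ ∂((fun m : Measure E => m.bind κ)^[n] μ) ≤ ENNReal.ofReal m := by
  have hn : Measurable fun x : E => ENNReal.ofReal ‖x‖ := by fun_prop
  induction n with
  | zero => exact hμ
  | succ n ih =>
    rw [Function.iterate_succ_apply']
    have := isProbabilityMeasure_bind_iterate (κ := κ) μ n
    rw [Measure.lintegral_bind κ.aemeasurable hn.aemeasurable]
    calc _ ≤ ∫⁻ x, (ENNReal.ofReal α * ENNReal.ofReal ‖x‖ + ENNReal.ofReal c)
            ∂((fun m : Measure E => m.bind κ)^[n] μ) := lintegral_mono hmom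
      _ = ENNReal.ofReal α * ∫⁻ x, ENNReal.ofReal ‖x‖ ∂((fun m : Measure E => m.bind κ)^[n] μ)
            + ENNReal.ofReal c := by
          rw [lintegral_add_right _ measurable_const, lintegral_const_mul _ hn]; simp
      _ ≤ ENNReal.ofReal α * ENNReal.ofReal m + ENNReal.ofReal c := by gcongr
      _ ≤ ENNReal.ofReal m := by
          rw [← ENNReal.ofReal_mul hα0, ← ENNReal.ofReal_add (by positivity) hc]
          exact ENNReal.ofReal_le_ofReal hmc

omit [BorelSpace E] in
lemma integrable_norm_of_lintegral_lt_top [OpensMeasurableSpace E] {μ : Measure E}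
    (h : ∫⁻ x, ENNReal.ofReal ‖x‖ ∂μ < ⊤) : Integrable (fun x : E => ‖x‖) μ := by
  refine ⟨measurable_norm.aestronglyMeasurable, ?_⟩
  rw [hasFiniteIntegral_iff_ofReal (.of_forall fun x => norm_nonneg x)]
  exact h

lemma integral_norm_le_of_lintegral_le {μ : Measure E} {m : ℝ} (hm : 0 ≤ m)
    (h : ∫⁻ x, ENNReal.ofReal ‖x‖ ∂μ ≤ ENNReal.ofReal m) : ∫ x, ‖x‖ ∂μ ≤ m := by
  rw [integral_eq_lintegral_of_nonneg_ae (.of_forall fun x => norm_nonneg x)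
    measurable_norm.aestronglyMeasurable]
  exact ENNReal.toReal_le_of_le_ofReal hm h

lemma abs_sub_integral_le {g : E → ℝ} {K β m : ℝ} {x : E} (hK : 0 ≤ K) (hβ : 0 ≤ β)
    (hg : Measurable g) (hM : ∀ x, |g x| ≤ M)
    (h : ∀ y, |g x - g y| ≤ K * (1 + β * ‖x‖ + β * ‖y‖)) (ν : Measure E)
    [IsProbabilityMeasure ν] (hm : 0 ≤ m)
    (hν : ∫⁻ x, ENNReal.ofReal ‖x‖ ∂ν ≤ ENNReal.ofReal m) :
    |g x - ∫ y, g y ∂ν| ≤ K * (1 + β * ‖x‖ + β * m) := by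
  have hi := integrable_norm_of_lintegral_lt_top (hν.trans_lt ENNReal.ofReal_lt_top)
  have hgi := integrable_of_measurable_of_abs_le hg hM ν
  have e : g x - ∫ y, g y ∂ν = ∫ y, (g x - g y) ∂ν := by
    rw [integral_sub (integrable_const _) hgi]; simp
  rw [e]
  calc |∫ y, (g x - g y) ∂ν| ≤ ∫ y, |g x - g y| ∂ν := abs_integral_le_integral_abs
    _ ≤ ∫ y, K * (1 + β * ‖x‖ + β * ‖y‖) ∂ν :=
        integral_mono_of_nonneg (.of_forall fun _ => abs_nonneg _)
          (((integrable_const _).add (hi.const_mul _)).const_mul _) (.of_forall h)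
    _ = K * (1 + β * ‖x‖ + β * ∫ y, ‖y‖ ∂ν) := by
        rw [integral_const_mul, integral_add (integrable_const _) (hi.const_mul _),
          integral_const_mul]
        simp
    _ ≤ _ := by have := integral_norm_le_of_lintegral_le hm hν; gcongr

lemma isTightMeasureSet_of_lintegral_norm_le [ProperSpace E] {S : Set (Measure E)} {m : ℝ}
    (h : ∀ μ ∈ S, ∫⁻ x, ENNReal.ofReal ‖x‖ ∂μ ≤ ENNReal.ofReal m) : IsTightMeasureSet S := by
  refine isTightMeasureSet_of_tendsto_measure_norm_gt ?_
  have hlim : Tendsto (fun r : ℝ => ENNReal.ofReal m / ENNReal.ofReal r) atTop (nhds 0) := by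
    rw [← ENNReal.div_top (a := ENNReal.ofReal m)]
    exact ENNReal.Tendsto.const_div ENNReal.tendsto_ofReal_atTop (Or.inr ENNReal.ofReal_ne_top)
  refine tendsto_of_tendsto_of_tendsto_of_le_of_le' tendsto_const_nhds hlim
    (.of_forall fun _ => zero_le) ?_
  filter_upwards [eventually_gt_atTop 0] with r hr
  refine iSup₂_le fun μ hμ => ?_
  calc μ {x | r < ‖x‖} ≤ μ {x | ENNReal.ofReal r ≤ ENNReal.ofReal ‖x‖} :=
        measure_mono fun x hx => ENNReal.ofReal_le_ofReal (le_of_lt hx)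
    _ ≤ (∫⁻ x, ENNReal.ofReal ‖x‖ ∂μ) / ENNReal.ofReal r :=
        meas_ge_le_lintegral_div (by fun_prop) (by simpa using hr) ENNReal.ofReal_ne_top
    _ ≤ _ := by gcongr; exact h μ hμ

lemma lintegral_norm_le_of_forall_truncation {μ : Measure E} [IsProbabilityMeasure μ] {m : ℝ}
    (h : ∀ N : ℕ, ∫ x, min ‖x‖ N ∂μ ≤ m) :
    ∫⁻ x, ENNReal.ofReal ‖x‖ ∂μ ≤ ENNReal.ofReal m := by
  have e : ∀ x : E, ENNReal.ofReal ‖x‖ = ⨆ N : ℕ, ENNReal.ofReal (min ‖x‖ N) := fun x => by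
    refine le_antisymm ?_ (iSup_le fun N => ENNReal.ofReal_le_ofReal (min_le_left _ _))
    obtain ⟨N, hN⟩ := exists_nat_ge ‖x‖
    exact le_iSup_of_le N (by rw [min_eq_left hN])
  simp_rw [e]
  rw [lintegral_iSup (fun N => by fun_prop)]
  · refine iSup_le fun N => ?_
    rw [← ofReal_integral_eq_lintegral_ofReal]
    · exact ENNReal.ofReal_le_ofReal (h N)
    · refine integrable_of_measurable_of_abs_le (M := N) (by fun_prop) (fun x => ?_) μ
      rw [abs_of_nonneg (by positivity)]; exact min_le_right _ _
    · exact .of_forall fun x => by positivity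
  · intro N N' hN x
    refine ENNReal.ofReal_le_ofReal (min_le_min_left _ ?_)
    exact_mod_cast hN

end MarkovOperator

section HarrisTheorem

variable {E : Type*} [MeasurableSpace E] [NormedAddCommGroup E] [BorelSpace E] [ProperSpace E]

/-- A weak Harris theorem: a Markov kernel with a linear drift condition that contracts
differences of test functions with respect to a distance-like function has a unique invariant
probability measure, which attracts every probability measure weakly, and exponentially fast in
the Fortet–Mourier distance when the first moment is finite. -/
theorem exists_invariant_of_contracting (κ : Kernel E E) [IsMarkovKernel κ]
    {α c q β K₀ : ℝ} (hα0 : 0 ≤ α) (hα1 : α < 1) (hc : 0 ≤ c) (hq0 : 0 < q) (hq1 : q < 1)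
    (hβ : 0 ≤ β) (hK₀ : 0 ≤ K₀)
    (hmom : ∀ x, ∫⁻ y, ENNReal.ofReal ‖y‖ ∂κ x ≤
      ENNReal.ofReal α * ENNReal.ofReal ‖x‖ + ENNReal.ofReal c)
    {D : E → E → ℝ}
    (hD : ∀ f : E → ℝ, Measurable f → (∃ M, ∀ x, |f x| ≤ M) → ∀ K, 0 ≤ K →
      (∀ x y, |f x - f y| ≤ K * D x y) →
      ∀ x y, |markovOp κ f x - markovOp κ f y| ≤ K * q * D x y)
    (hDle : ∀ x y, D x y ≤ 1 + β * ‖x‖ + β * ‖y‖)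
    (hDge : ∀ x y, min 1 (dist x y) ≤ K₀ * D x y)
    (hDlim : ∀ x, Tendsto (fun y => D y x) (nhds x) (nhds 0)) :
    ∃ μstar : Measure E, IsProbabilityMeasure μstar ∧
      (∫⁻ x, ENNReal.ofReal ‖x‖ ∂μstar < ⊤) ∧ μstar.bind κ = μstar ∧
      (∀ μ' : Measure E, IsProbabilityMeasure μ' → μ'.bind κ = μ' → μ' = μstar) ∧
      (∀ μ : Measure E, IsProbabilityMeasure μ →
        ∀ f : E → ℝ, Continuous f → (∃ M, ∀ x, |f x| ≤ M) →
        Tendsto (fun n => ∫ x, (markovOp κ)^[n] f x ∂μ) atTop (nhds (∫ x, f x ∂μstar))) ∧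
      ∃ C : ℝ, 0 < C ∧ ∀ μ : Measure E, IsProbabilityMeasure μ →
        (∫⁻ x, ENNReal.ofReal ‖x‖ ∂μ < ⊤) → ∀ n : ℕ,
        fmDist ((fun m : Measure E => m.bind κ)^[n] μ) μstar
          ≤ q ^ n * C * (1 + ∫ x, ‖x‖ ∂μ) := by
  set m : ℝ := c / (1 - α) with hm_def
  have hm : 0 ≤ m := div_nonneg hc (by linarith)
  have hmc : α * m + c ≤ m := by
    have : m * (1 - α) = c := by rw [hm_def]; field_simp [show (1 - α) ≠ 0 by linarith]
    nlinarith
  -- bounded Lipschitz functions are controlled by `D`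
  have hlipK : ∀ (f : E → ℝ) (M L : ℝ), 0 ≤ M → 0 ≤ L → (∀ x, |f x| ≤ M) →
      (∀ x y, |f x - f y| ≤ L * dist x y) →
      ∀ x y, |f x - f y| ≤ (2 * M + L) * K₀ * D x y := by
    intro f M L hM0 hL hM hf x y
    have h1 : |f x - f y| ≤ (2 * M + L) * min 1 (dist x y) := by
      rcases le_total 1 (dist x y) with h | h
      · rw [min_eq_left h]
        have := abs_sub (f x) (f y); have := hM x; have := hM y; linarith
      · rw [min_eq_right h]
        have := hf x y
        have : 0 ≤ 2 * M * dist x y := by positivity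
        linarith
    refine h1.trans ?_
    rw [mul_assoc]
    exact mul_le_mul_of_nonneg_left (hDge x y) (by positivity)
  have hiter : ∀ {f : E → ℝ} {M K : ℝ}, Measurable f → (∀ x, |f x| ≤ M) → 0 ≤ K →
      (∀ x y, |f x - f y| ≤ K * D x y) → ∀ n x y,
      |(markovOp κ)^[n] f x - (markovOp κ)^[n] f y| ≤ K * q ^ n * D x y :=
    fun hf hM hK hfK => markovOp_iterate_sub_le hq0.le hD hK hf hM hfK
  have hiter' : ∀ {f : E → ℝ} {M K : ℝ}, Measurable f → (∀ x, |f x| ≤ M) → 0 ≤ K →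
      (∀ x y, |f x - f y| ≤ K * D x y) → ∀ n x (ν : Measure E), IsProbabilityMeasure ν →
      (∫⁻ x, ENNReal.ofReal ‖x‖ ∂ν ≤ ENNReal.ofReal m) →
      |(markovOp κ)^[n] f x - ∫ y, (markovOp κ)^[n] f y ∂ν|
        ≤ K * q ^ n * (1 + β * ‖x‖ + β * m) := by
    intro f M K hf hM hK hfK n x ν _ hν
    refine abs_sub_integral_le (by positivity) hβ (hf.markovOp_iterate n)
      (abs_markovOp_iterate_le hM n) (fun y => ?_) ν hm hν
    exact (hiter hf hM hK hfK n x y).trans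
      (mul_le_mul_of_nonneg_left (hDle x y) (by positivity))
  have hcont : ∀ {f : E → ℝ} {M K : ℝ}, Measurable f → (∀ x, |f x| ≤ M) → 0 ≤ K →
      (∀ x y, |f x - f y| ≤ K * D x y) → ∀ n, Continuous ((markovOp κ)^[n] f) := by
    intro f M K hf hM hK hfK n
    refine continuous_iff_continuousAt.2 fun x => ?_
    rw [ContinuousAt, tendsto_iff_dist_tendsto_zero]
    refine squeeze_zero (fun _ => dist_nonneg)
      (fun y => (Real.dist_eq _ _).le.trans (hiter hf hM hK hfK n y x)) ?_
    simpa using (hDlim x).const_mul (K * q ^ n)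
  have hqn : Tendsto (fun n : ℕ => q ^ n) atTop (nhds 0) :=
    tendsto_pow_atTop_nhds_zero_of_lt_one hq0.le hq1
  -- the orbit of the Dirac mass at the origin
  set ν : ℕ → Measure E := fun n => (fun m : Measure E => m.bind κ)^[n] (Measure.dirac 0) with hν
  have hνp : ∀ n, IsProbabilityMeasure (ν n) := fun n => isProbabilityMeasure_bind_iterate _ n
  have hνm : ∀ n, ∫⁻ x, ENNReal.ofReal ‖x‖ ∂ν n ≤ ENNReal.ofReal m := fun n =>
    lintegral_norm_bind_iterate_le hα0 hm hc hmc hmom _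
      (by rw [lintegral_dirac' _ (by fun_prop)]; simp) n
  have hνint : ∀ {f : E → ℝ} {M : ℝ}, Measurable f → (∀ x, |f x| ≤ M) → ∀ n,
      ∫ x, f x ∂ν n = (markovOp κ)^[n] f 0 := fun {f M} hf hM n => by
    rw [hν, integral_bind_iterate hf hM,
      integral_dirac' _ _ (hf.markovOp_iterate n).stronglyMeasurable]
  set P : ℕ → ProbabilityMeasure E := fun n => ⟨ν n, hνp n⟩ with hP
  have hcomp : IsCompact (closure (range P)) := by
    refine isCompact_closure_of_isTightMeasureSet
      (isTightMeasureSet_of_lintegral_norm_le (m := m) ?_)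
    rintro _ ⟨_, ⟨n, rfl⟩, rfl⟩
    exact hνm n
  set F : Ultrafilter ℕ := hyperfilter ℕ with hF
  have hFle : (F : Filter ℕ) ≤ atTop := by rw [← Nat.cofinite_eq_atTop]; exact hyperfilter_le_cofinite
  obtain ⟨μs, -, hμs⟩ := hcomp.ultrafilter_le_nhds (F.map P)
    (by
      rw [le_principal_iff]
      exact Filter.mem_map.2 (Filter.univ_mem' fun n => subset_closure (mem_range_self n)))
  have hμs : Tendsto P F (nhds μs) := hμs
  have hlim : ∀ {f : E → ℝ} {M : ℝ}, Continuous f → (∀ x, |f x| ≤ M) →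
      Tendsto (fun n => (markovOp κ)^[n] f 0) F (nhds (∫ x, f x ∂(μs : Measure E))) := by
    intro f M hf hM
    have := (ProbabilityMeasure.tendsto_iff_forall_integral_tendsto.1 hμs)
      (BoundedContinuousFunction.ofNormedAddCommGroup f hf M hM)
    refine this.congr fun n => ?_
    exact hνint hf.measurable hM n
  have hstarm : ∫⁻ x, ENNReal.ofReal ‖x‖ ∂(μs : Measure E) ≤ ENNReal.ofReal m := by
    refine lintegral_norm_le_of_forall_truncation fun N => ?_
    have hb : ∀ x : E, |min ‖x‖ N| ≤ N := fun x => by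
      rw [abs_of_nonneg (by positivity)]; exact min_le_right _ _
    have hc : Continuous fun x : E => min ‖x‖ (N : ℝ) := by fun_prop
    refine le_of_tendsto (hlim hc hb) (.of_forall fun n => ?_)
    rw [← hνint hc.measurable hb n]
    refine le_trans ?_ (integral_norm_le_of_lintegral_le hm (hνm n))
    exact integral_mono (integrable_of_measurable_of_abs_le hc.measurable hb _)
      (integrable_norm_of_lintegral_lt_top ((hνm n).trans_lt ENNReal.ofReal_lt_top))
      fun x => min_le_left _ _
  -- bounds for Lipschitz test functions in the form used by the portmanteau theorem
  have hlip : ∀ f : E → ℝ, (∃ C : ℝ, ∀ x y, dist (f x) (f y) ≤ C) →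
      (∃ L, LipschitzWith L f) → Continuous f ∧ ∃ M K : ℝ, 0 ≤ K ∧ (∀ x, |f x| ≤ M) ∧
        ∀ x y, |f x - f y| ≤ K * D x y := by
    rintro f ⟨C, hC⟩ ⟨L, hL⟩
    have hM : ∀ x, |f x| ≤ |f 0| + C := fun x => by
      have := hC x 0
      rw [Real.dist_eq] at this
      have := abs_sub_abs_le_abs_sub (f x) (f 0)
      linarith
    have hM0 : 0 ≤ |f 0| + C := (abs_nonneg _).trans (hM 0)
    refine ⟨hL.continuous, |f 0| + C, (2 * (|f 0| + C) + L) * K₀, by positivity, hM, ?_⟩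
    exact hlipK f _ L hM0 L.2 hM fun x y => by
      rw [← Real.dist_eq]; exact hL.dist_le_mul x y
  have hinv : (μs : Measure E).bind κ = μs := by
    set Q : ProbabilityMeasure E := ⟨(μs : Measure E).bind κ, inferInstance⟩ with hQ
    have hT : Tendsto (fun _ : ℕ => Q) atTop (nhds μs) := by
      rw [tendsto_iff_forall_lipschitz_integral_tendsto]
      intro f hb hl
      obtain ⟨hfc, M, K, hK, hM, hfK⟩ := hlip f hb hl
      have hfm := hfc.measurable
      have e : ∫ x, f x ∂((μs : Measure E).bind κ) = ∫ x, f x ∂(μs : Measure E) := by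
        rw [integral_bind_kernel hfm hM]
        have l1 := hlim (hcont hfm hM hK hfK 1) (abs_markovOp_iterate_le hM 1)
        have l2 := hlim hfc hM
        have l3 : Tendsto (fun n => (markovOp κ)^[n] f 0 -
            (markovOp κ)^[n] ((markovOp κ)^[1] f) 0) F (nhds 0) := by
          refine Tendsto.mono_left ?_ hFle
          refine squeeze_zero_norm (a := fun n => K * q ^ n * (1 + β * ‖(0 : E)‖ + β * m))
            (fun n => ?_) ?_
          · have e1 : (markovOp κ)^[n] ((markovOp κ)^[1] f) 0
                = ∫ y, (markovOp κ)^[n] f y ∂(ν 1) := by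
              rw [hνint (hfm.markovOp_iterate n) (abs_markovOp_iterate_le hM n),
                ← Function.iterate_add_apply, ← Function.iterate_add_apply, add_comm]
            rw [e1]
            exact hiter' hfm hM hK hfK n 0 (ν 1) (hνp 1) (hνm 1)
          · simpa using (hqn.const_mul K).mul_const (1 + β * ‖(0 : E)‖ + β * m)
        have l4 := l2.sub l1
        have := tendsto_nhds_unique l3 l4
        simp only [Function.iterate_one] at this
        linarith
      simp only [hQ, ProbabilityMeasure.coe_mk, e]
      exact tendsto_const_nhds
    have := tendsto_nhds_unique tendsto_const_nhds hT
    exact congrArg (fun p : ProbabilityMeasure E => (p : Measure E)) this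
  have hinvn : ∀ {f : E → ℝ} {M : ℝ}, Measurable f → (∀ x, |f x| ≤ M) → ∀ n,
      ∀ μ' : Measure E, IsProbabilityMeasure μ' → μ'.bind κ = μ' →
      ∫ x, (markovOp κ)^[n] f x ∂μ' = ∫ x, f x ∂μ' := by
    intro f M hf hM n μ' _ h
    rw [← integral_bind_iterate hf hM, Function.iterate_fixed h]
  have hpoint : ∀ {f : E → ℝ} {M K : ℝ}, Measurable f → (∀ x, |f x| ≤ M) → 0 ≤ K →
      (∀ x y, |f x - f y| ≤ K * D x y) → ∀ n x,
      |(markovOp κ)^[n] f x - ∫ y, f y ∂(μs : Measure E)|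
        ≤ K * q ^ n * (1 + β * ‖x‖ + β * m) := by
    intro f M K hf hM hK hfK n x
    rw [← hinvn hf hM n μs inferInstance hinv]
    exact hiter' hf hM hK hfK n x μs inferInstance hstarm
  have hattr : ∀ μ : Measure E, IsProbabilityMeasure μ →
      ∀ f : E → ℝ, Continuous f → (∃ M, ∀ x, |f x| ≤ M) →
      Tendsto (fun n => ∫ x, (markovOp κ)^[n] f x ∂μ) atTop
        (nhds (∫ x, f x ∂(μs : Measure E))) := by
    intro μ hμ f hf ⟨M, hM⟩
    set Q : ℕ → ProbabilityMeasure E := fun n => ⟨(fun m : Measure E => m.bind κ)^[n] μ,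
      isProbabilityMeasure_bind_iterate μ n⟩ with hQ
    have hT : Tendsto Q atTop (nhds μs) := by
      rw [tendsto_iff_forall_lipschitz_integral_tendsto]
      intro g hb hl
      obtain ⟨hgc, M, K, hK, hM, hgK⟩ := hlip g hb hl
      have hgm := hgc.measurable
      simp only [hQ, ProbabilityMeasure.coe_mk]
      simp_rw [integral_bind_iterate hgm hM]
      have e : ∫ x, g x ∂(μs : Measure E) = ∫ _, (∫ x, g x ∂(μs : Measure E)) ∂μ := by simp
      rw [e]
      refine tendsto_integral_of_dominated_convergence (fun _ => M)
        (fun n => (hgm.markovOp_iterate n).aestronglyMeasurable) (integrable_const _)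
        (fun n => .of_forall fun x => abs_markovOp_iterate_le hM n x) (.of_forall fun x => ?_)
      rw [tendsto_iff_dist_tendsto_zero]
      refine squeeze_zero (fun _ => dist_nonneg)
        (fun n => (Real.dist_eq _ _).le.trans (hpoint hgm hM hK hgK n x)) ?_
      simpa using (hqn.const_mul K).mul_const (1 + β * ‖x‖ + β * m)
    have := (ProbabilityMeasure.tendsto_iff_forall_integral_tendsto.1 hT)
      (BoundedContinuousFunction.ofNormedAddCommGroup f hf M hM)
    refine this.congr fun n => ?_
    exact integral_bind_iterate hf.measurable hM μ n
  refine ⟨μs, inferInstance, hstarm.trans_lt ENNReal.ofReal_lt_top, hinv, ?_, hattr,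
    3 * K₀ * (1 + β * m + β) + 1, by positivity, ?_⟩
  · intro μ' hμ' h
    refine ext_of_forall_integral_eq_of_IsFiniteMeasure fun f => ?_
    have hfM : ∀ x, |f x| ≤ ‖f‖ := fun x => f.norm_coe_le_norm x
    refine tendsto_nhds_unique ?_ (hattr μ' hμ' f f.continuous ⟨‖f‖, hfM⟩)
    simp_rw [fun n => hinvn f.continuous.measurable hfM n μ' hμ' h]
    exact tendsto_const_nhds
  · intro μ hμ hμm n
    have hi := integrable_norm_of_lintegral_lt_top hμm
    have hI : 0 ≤ ∫ x, ‖x‖ ∂μ := integral_nonneg fun x => norm_nonneg x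
    refine Real.sSup_le ?_ (by positivity)
    rintro r ⟨f, hfc, hf1, hfl, rfl⟩
    have hK : ∀ x y, |f x - f y| ≤ 3 * K₀ * D x y := fun x y => by
      have := hlipK f 1 1 zero_le_one zero_le_one hf1 (fun x y => by simpa using hfl x y) x y
      norm_num at this; exact this
    have hfm := hfc.measurable
    rw [integral_bind_iterate hfm hf1]
    have hgi := integrable_of_measurable_of_abs_le (hfm.markovOp_iterate (κ := κ) n)
      (abs_markovOp_iterate_le hf1 n) μ
    have e : ∫ x, (markovOp κ)^[n] f x ∂μ - ∫ x, f x ∂(μs : Measure E)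
        = ∫ x, ((markovOp κ)^[n] f x - ∫ x, f x ∂(μs : Measure E)) ∂μ := by
      rw [integral_sub hgi (integrable_const _)]; simp
    rw [e]
    calc |∫ x, ((markovOp κ)^[n] f x - ∫ x, f x ∂(μs : Measure E)) ∂μ|
        ≤ ∫ x, |(markovOp κ)^[n] f x - ∫ x, f x ∂(μs : Measure E)| ∂μ :=
          abs_integral_le_integral_abs
      _ ≤ ∫ x, 3 * K₀ * q ^ n * (1 + β * ‖x‖ + β * m) ∂μ := by
          refine integral_mono_of_nonneg (.of_forall fun _ => abs_nonneg _)
            ((((integrable_const _).add (hi.const_mul _)).add (integrable_const _)).const_mul _)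
            (.of_forall fun x => hpoint hfm hf1 (by positivity) hK n x)
      _ = 3 * K₀ * q ^ n * (1 + β * ∫ x, ‖x‖ ∂μ + β * m) := by
          have e1 : ∀ x : E, 1 + β * ‖x‖ + β * m = (1 + β * m) + β * ‖x‖ := fun x => by ring
          simp_rw [e1]
          rw [integral_const_mul, integral_add (integrable_const _) (hi.const_mul _),
            integral_const_mul, integral_const, probReal_univ, one_smul]
          ring
      _ = q ^ n * (3 * K₀ * (1 + β * m + β * ∫ x, ‖x‖ ∂μ)) := by ring
      _ ≤ q ^ n * ((3 * K₀ * (1 + β * m + β) + 1) * (1 + ∫ x, ‖x‖ ∂μ)) := by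
          refine mul_le_mul_of_nonneg_left ?_ (by positivity)
          have h1 : 0 ≤ 3 * K₀ * (1 + β * m) * ∫ x, ‖x‖ ∂μ := by positivity
          have h2 : 0 ≤ 3 * K₀ * β := by positivity
          nlinarith
      _ = _ := by ring

end HarrisTheorem

/-- Constants for which the drift condition turns a contraction of the gauge into a contraction of
the weighted distance. -/
lemma exists_drift_constants {q₁ α c : ℝ} (hq0 : 0 < q₁) (hq1 : q₁ < 1)
    (hα1 : α < 1) (hc : 0 ≤ c) :
    ∃ β Q : ℝ, 0 < β ∧ 0 < Q ∧ Q < 1 ∧ ∀ V, 0 ≤ V →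
      q₁ * (1 + 2 * β * c + α * β * V) ≤ Q * (1 + β * V) ∧
      (4 * c / (1 - α) + 1 ≤ V → 1 + 2 * β * c + α * β * V ≤ Q * (1 + β * V)) := by
  set h := 1 - q₁ with hh
  obtain ⟨β, hβ, hβc⟩ : ∃ β : ℝ, 0 < β ∧ 2 * β * c ≤ h / 2 := by
    refine ⟨h / (4 * (c + 1)), div_pos (by linarith) (by linarith), ?_⟩
    calc 2 * (h / (4 * (c + 1))) * c = h / 2 * (c / (c + 1)) := by field_simp; ring
      _ ≤ h / 2 * 1 := by
        gcongr
        rw [div_le_one (by linarith)]; linarith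
      _ = h / 2 := mul_one _
  set R := 4 * c / (1 - α) + 1 with hR
  have hR0 : 0 < R := by
    have : 0 ≤ 4 * c / (1 - α) := div_nonneg (by linarith) (by linarith)
    linarith
  have hRc : 4 * c ≤ R * (1 - α) := by
    rw [hR, add_mul, div_mul_cancel₀ _ (by linarith)]; linarith
  set γ := (1 + α) / 2 with hγ
  have hβR : 0 < β * R := mul_pos hβ hR0
  set q₃ := (1 + γ * (β * R)) / (1 + β * R) with hq₃
  have hq₃1 : q₃ < 1 := by
    rw [hq₃, div_lt_one (by linarith)]
    nlinarith
  refine ⟨β, max (1 - h / 2) q₃, hβ, lt_max_of_lt_left (by linarith), max_lt (by linarith) hq₃1,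
    fun V hV => ⟨?_, fun hRV => ?_⟩⟩
  · have hβV : 0 ≤ β * V := by positivity
    refine le_trans ?_ (mul_le_mul_of_nonneg_right (le_max_left _ _) (by positivity))
    have h1 : 1 + 2 * β * c + α * β * V ≤ (1 + h / 2) * (1 + β * V) := by nlinarith
    calc q₁ * (1 + 2 * β * c + α * β * V) ≤ q₁ * ((1 + h / 2) * (1 + β * V)) := by gcongr
      _ = (q₁ * (1 + h / 2)) * (1 + β * V) := by ring
      _ ≤ _ := by gcongr; nlinarith
  · refine le_trans ?_ (mul_le_mul_of_nonneg_right (le_max_right _ _) (by positivity))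
    have h1 : 4 * c ≤ V * (1 - α) :=
      hRc.trans (mul_le_mul_of_nonneg_right hRV (by linarith))
    have h2 : 1 + 2 * β * c + α * β * V ≤ 1 + γ * (β * V) := by
      have := mul_le_mul_of_nonneg_left h1 hβ.le
      rw [hγ]
      linarith
    refine h2.trans ?_
    have h3 : β * R ≤ β * V := by gcongr
    have hγ1 : γ ≤ 1 := by linarith
    clear_value γ
    rw [hq₃, div_mul_eq_mul_div, le_div_iff₀ (by linarith)]
    linarith [mul_nonneg (sub_nonneg.2 hγ1) (sub_nonneg.2 h3)]

/-- Jensen's inequality for `t ↦ t ^ p` with `0 ≤ p ≤ 1`, with an upper bound for the mean. -/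
lemma lintegral_rpow_le_of_lintegral_le {Ω : Type*} [MeasurableSpace Ω] {μ : Measure Ω}
    [IsProbabilityMeasure μ] {X : Ω → ℝ} (hX : Measurable X) (hX0 : ∀ ω, 0 ≤ X ω) {b p : ℝ}
    (hb : 0 < b) (hp0 : 0 ≤ p) (hp1 : p ≤ 1)
    (h : ∫⁻ ω, ENNReal.ofReal (X ω) ∂μ ≤ ENNReal.ofReal b) :
    ∫⁻ ω, ENNReal.ofReal (X ω ^ p) ∂μ ≤ ENNReal.ofReal (b ^ p) := by
  have hbp : 0 < b ^ p := Real.rpow_pos_of_pos hb p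
  have key : ∀ t : ℝ, 0 ≤ t → t ^ p ≤ b ^ p * (1 - p) + b ^ p * p / b * t := fun t ht => by
    have h1 := rpow_one_add_le_one_add_mul_self (s := t / b - 1)
      (by have : 0 ≤ t / b := by positivity
          linarith) hp0 hp1
    rw [add_sub_cancel, Real.div_rpow ht hb.le, div_le_iff₀ hbp] at h1
    refine h1.trans (le_of_eq ?_)
    field_simp
    ring
  have h1p : 0 ≤ b ^ p * (1 - p) := mul_nonneg hbp.le (by linarith)
  calc ∫⁻ ω, ENNReal.ofReal (X ω ^ p) ∂μ
      ≤ ∫⁻ ω, (ENNReal.ofReal (b ^ p * (1 - p)) +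
          ENNReal.ofReal (b ^ p * p / b) * ENNReal.ofReal (X ω)) ∂μ := by
        refine lintegral_mono fun ω => ?_
        rw [← ENNReal.ofReal_mul (by positivity),
          ← ENNReal.ofReal_add h1p (mul_nonneg (by positivity) (hX0 ω))]
        exact ENNReal.ofReal_le_ofReal (key _ (hX0 ω))
    _ = ENNReal.ofReal (b ^ p * (1 - p)) +
          ENNReal.ofReal (b ^ p * p / b) * ∫⁻ ω, ENNReal.ofReal (X ω) ∂μ := by
        rw [lintegral_add_left measurable_const, lintegral_const_mul _ (by fun_prop)]; simp
    _ ≤ ENNReal.ofReal (b ^ p * (1 - p)) + ENNReal.ofReal (b ^ p * p / b) * ENNReal.ofReal b := by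
        gcongr
    _ = ENNReal.ofReal (b ^ p) := by
        rw [← ENNReal.ofReal_mul (by positivity), ← ENNReal.ofReal_add h1p (by positivity)]
        congr 1
        field_simp
        ring

/-- A function bounded by one that is at most `b` on a set of `θ`-measure at least `δ`. -/
lemma lintegral_add_defect_le {Ω : Type*} [MeasurableSpace Ω] {θ : Measure Ω} [IsFiniteMeasure θ]
    (hθ : θ univ ≤ 1) {G : Set Ω} (hG : MeasurableSet G) {δ b : ℝ} (hδG : δ ≤ θ.real G)
    (hb0 : 0 ≤ b) (hb1 : b ≤ 1) {h : Ω → ℝ≥0∞} (h1 : ∀ ω, h ω ≤ 1)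
    (hG' : ∀ ω ∈ G, h ω ≤ ENNReal.ofReal b) :
    ∫⁻ ω, h ω ∂θ + (1 - θ univ) ≤ ENNReal.ofReal (1 - δ * (1 - b)) := by
  have hθr : θ.real univ ≤ 1 := ENNReal.toReal_le_of_le_ofReal zero_le_one (by simpa using hθ)
  have hGr : θ.real Gᶜ = θ.real univ - θ.real G := by
    rw [measureReal_compl hG]
  calc ∫⁻ ω, h ω ∂θ + (1 - θ univ)
      = ∫⁻ ω in G, h ω ∂θ + ∫⁻ ω in Gᶜ, h ω ∂θ + (1 - θ univ) := by
        rw [lintegral_add_compl _ hG]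
    _ ≤ ∫⁻ ω in G, ENNReal.ofReal b ∂θ + ∫⁻ ω in Gᶜ, 1 ∂θ + (1 - θ univ) := by
        gcongr ?_ + ?_ + _
        · exact setLIntegral_mono' hG hG'
        · exact lintegral_mono h1
    _ = ENNReal.ofReal (b * θ.real G + θ.real Gᶜ + (1 - θ.real univ)) := by
        rw [setLIntegral_const, setLIntegral_one,
          ENNReal.ofReal_add (by positivity) (by linarith),
          ENNReal.ofReal_add (by positivity) (by positivity), ENNReal.ofReal_mul hb0,
          ENNReal.ofReal_sub _ (by positivity), ofReal_measureReal, ofReal_measureReal,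
          ofReal_measureReal, ENNReal.ofReal_one]
    _ ≤ _ := by
        refine ENNReal.ofReal_le_ofReal ?_
        rw [hGr]
        nlinarith

/-- Comparison of the integrals of a test function against the marginals of a coupling, when the
test function is controlled by the geometric mean of a bounded gauge and a linear weight. -/
lemma abs_integral_map_fst_sub_map_snd_le {E : Type*} [NormedAddCommGroup E] [MeasurableSpace E]
    [BorelSpace E] {π : Measure (E × E)} [IsProbabilityMeasure π]
    {Φ : E × E → ℝ} (hΦ : Measurable Φ) (hΦ0 : ∀ z, 0 ≤ Φ z) {β u v A K M : ℝ} (hβ : 0 ≤ β)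
    (hu : 0 ≤ u) (hv : 0 ≤ v) (hA : 0 < A) (hK : 0 ≤ K)
    (hfst : ∫⁻ x, ENNReal.ofReal ‖x‖ ∂(π.map Prod.fst) ≤ ENNReal.ofReal u)
    (hsnd : ∫⁻ x, ENNReal.ofReal ‖x‖ ∂(π.map Prod.snd) ≤ ENNReal.ofReal v)
    (hΦA : ∫⁻ z, ENNReal.ofReal (Φ z) ∂π ≤ ENNReal.ofReal A)
    {f : E → ℝ} (hf : Measurable f) (hM : ∀ x, |f x| ≤ M)
    (h : ∀ x y, |f x - f y| ≤ K * √(Φ (x, y) * (1 + β * ‖x‖ + β * ‖y‖))) :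
    |∫ x, f x ∂(π.map Prod.fst) - ∫ x, f x ∂(π.map Prod.snd)| ≤
      K * √(A * (1 + β * u + β * v)) := by
  have : IsProbabilityMeasure (π.map Prod.fst) :=
    Measure.isProbabilityMeasure_map measurable_fst.aemeasurable
  have : IsProbabilityMeasure (π.map Prod.snd) :=
    Measure.isProbabilityMeasure_map measurable_snd.aemeasurable
  have i1 : Integrable (fun z : E × E => ‖z.1‖) π :=
    (integrable_norm_of_lintegral_lt_top
      (hfst.trans_lt ENNReal.ofReal_lt_top)).comp_measurable measurable_fst
  have i2 : Integrable (fun z : E × E => ‖z.2‖) π :=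
    (integrable_norm_of_lintegral_lt_top
      (hsnd.trans_lt ENNReal.ofReal_lt_top)).comp_measurable measurable_snd
  have b1 : ∫ z, ‖z.1‖ ∂π ≤ u := by
    have := integral_norm_le_of_lintegral_le hu hfst
    rwa [integral_map measurable_fst.aemeasurable measurable_norm.aestronglyMeasurable] at this
  have b2 : ∫ z, ‖z.2‖ ∂π ≤ v := by
    have := integral_norm_le_of_lintegral_le hv hsnd
    rwa [integral_map measurable_snd.aemeasurable measurable_norm.aestronglyMeasurable] at this
  have iΦ : Integrable Φ π := by
    refine ⟨hΦ.aestronglyMeasurable, ?_⟩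
    rw [hasFiniteIntegral_iff_ofReal (.of_forall hΦ0)]
    exact hΦA.trans_lt ENNReal.ofReal_lt_top
  rw [integral_map measurable_fst.aemeasurable hf.aestronglyMeasurable,
    integral_map measurable_snd.aemeasurable hf.aestronglyMeasurable, ← integral_sub
      (f := fun z : E × E => f z.1) (g := fun z : E × E => f z.2)
      (integrable_of_measurable_of_abs_le (hf.comp measurable_fst) (fun z => hM z.1) π)
      (integrable_of_measurable_of_abs_le (hf.comp measurable_snd) (fun z => hM z.2) π)]
  refine abs_integral_fst_sub_snd_le π (X := Φ) (Y := fun z => 1 + β * ‖z.1‖ + β * ‖z.2‖) iΦ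
    (((integrable_const _).add (i1.const_mul β)).add (i2.const_mul β)) hΦ0
    (fun z => by positivity) hK (fun z => h z.1 z.2) hA (by positivity) ?_ ?_
  · rw [integral_eq_lintegral_of_nonneg_ae (.of_forall hΦ0) hΦ.aestronglyMeasurable]
    exact ENNReal.toReal_le_of_le_ofReal hA.le hΦA
  · have e : ∫ z, (1 + β * ‖z.1‖ + β * ‖z.2‖) ∂π =
        1 + β * ∫ z, ‖z.1‖ ∂π + β * ∫ z, ‖z.2‖ ∂π := by
      have i3 : Integrable (fun z : E × E => 1 + β * ‖z.1‖) π :=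
        (integrable_const _).add (i1.const_mul β)
      rw [integral_add i3 (i2.const_mul β), integral_add (integrable_const _) (i1.const_mul β),
        integral_const_mul, integral_const_mul]
      simp
    rw [e]
    gcongr

/-- A coupling of the one-step distributions of a random affine recursion from two starting
points, for which the mean of a gauge of the distance is small. -/
lemma exists_affine_coupling {d : ℕ} {μ ν : Measure (MatVec d)} [IsProbabilityMeasure μ]
    [IsProbabilityMeasure ν] {a δ k L p : ℝ} {φ : ℝ → ℝ} (hmono : Monotone φ)
    (hφ0 : ∀ t, 0 ≤ φ t) (hφ1 : ∀ t, φ t ≤ 1) (hk : 0 ≤ k) (hφk : ∀ t, 0 ≤ t → φ t ≤ k * t)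
    (ha : 0 < a) (hp : 0 < p) (hp1 : p ≤ 1)
    (hμ : ∫⁻ g, ENNReal.ofReal ‖g.1‖ ∂μ ≤ ENNReal.ofReal a) (hL : 0 ≤ L)
    (hconc : ENNReal.ofReal δ ≤ (μ ⊓ ν) {g : MatVec d | ‖g.1‖ ≤ a}) (x y : Euc d)
    (htv : tvNorm μ ν ≤ L * dist x y ^ p) :
    ∃ π : Measure (Euc d × Euc d), IsProbabilityMeasure π ∧
      π.map Prod.fst = μ.map (fun g => g.1 x + g.2) ∧
      π.map Prod.snd = ν.map (fun g => g.1 y + g.2) ∧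
      ∀ A, (k * a ^ p * dist x y ^ p + L * dist x y ^ p ≤ A ∨
          1 - δ * (1 - φ (a ^ p * dist x y ^ p)) ≤ A ∨ 1 ≤ A) →
        ∫⁻ z, ENNReal.ofReal (φ (dist z.1 z.2 ^ p)) ∂π ≤ ENNReal.ofReal A := by
  have hmeas : ∀ w : Euc d, Measurable fun g : MatVec d => g.1 w + g.2 := fun w =>
    ((ContinuousLinearMap.measurable_apply w).comp measurable_fst).add measurable_snd
  obtain ⟨π, hπ, h1, h2, h3⟩ := exists_coupling_of_common_part (μ := μ) (ν := ν)
    (θ := μ ⊓ ν) inf_le_left inf_le_right (hmeas x) (hmeas y)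
  have : IsFiniteMeasure (μ ⊓ ν) := isFiniteMeasure_of_le μ inf_le_left
  have hθ1 : (μ ⊓ ν) univ ≤ 1 :=
    (Measure.le_iff'.1 (inf_le_left : μ ⊓ ν ≤ μ) univ).trans measure_univ.le
  have hone : ∀ t, ENNReal.ofReal (φ t) ≤ 1 := fun t => by
    simpa using ENNReal.ofReal_le_ofReal (hφ1 t)
  have hΦ : Measurable fun z : Euc d × Euc d => ENNReal.ofReal (φ (dist z.1 z.2 ^ p)) :=
    (hmono.measurable.comp (by fun_prop)).ennreal_ofReal
  have hle := h3 _ hΦ fun z => hone _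
  have hdist : ∀ g : MatVec d, dist (g.1 x + g.2) (g.1 y + g.2) ≤ ‖g.1‖ * dist x y := fun g => by
    rw [dist_add_right, dist_eq_norm, ← map_sub, dist_eq_norm]
    exact g.1.le_opNorm _
  have hφd : ∀ g : MatVec d, φ (dist (g.1 x + g.2) (g.1 y + g.2) ^ p) ≤
      φ (‖g.1‖ ^ p * dist x y ^ p) := fun g => by
    rw [← Real.mul_rpow (norm_nonneg _) dist_nonneg]
    exact hmono (Real.rpow_le_rpow dist_nonneg (hdist g) hp.le)
  have hsp : 0 ≤ dist x y ^ p := Real.rpow_nonneg dist_nonneg p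
  have hap : 0 ≤ a ^ p := Real.rpow_nonneg ha.le p
  have hnorm : Measurable fun g : MatVec d => ‖g.1‖ := measurable_norm.comp measurable_fst
  refine ⟨π, hπ, h1, h2, fun A hA => ?_⟩
  rcases hA with hA | hA | hA
  · refine (hle.trans ?_).trans (ENNReal.ofReal_le_ofReal hA)
    rw [ENNReal.ofReal_add (by positivity) (by positivity)]
    refine add_le_add ?_ ((one_sub_inf_univ_le_tvNorm μ ν).trans (ENNReal.ofReal_le_ofReal htv))
    calc ∫⁻ g, ENNReal.ofReal (φ (dist (g.1 x + g.2) (g.1 y + g.2) ^ p)) ∂(μ ⊓ ν)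
        ≤ ∫⁻ g, ENNReal.ofReal (φ (dist (g.1 x + g.2) (g.1 y + g.2) ^ p)) ∂μ :=
          lintegral_mono' inf_le_left le_rfl
      _ ≤ ∫⁻ g, ENNReal.ofReal (k * dist x y ^ p) * ENNReal.ofReal (‖g.1‖ ^ p) ∂μ := by
          refine lintegral_mono fun g => ?_
          rw [← ENNReal.ofReal_mul (by positivity)]
          refine ENNReal.ofReal_le_ofReal ((hφd g).trans ((hφk _ (by positivity)).trans ?_))
          exact le_of_eq (by ring)
      _ ≤ ENNReal.ofReal (k * dist x y ^ p) * ENNReal.ofReal (a ^ p) := by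
          rw [lintegral_const_mul _ (by fun_prop)]
          gcongr
          exact lintegral_rpow_le_of_lintegral_le hnorm (fun g => norm_nonneg _) ha hp.le hp1 hμ
      _ = ENNReal.ofReal (k * a ^ p * dist x y ^ p) := by
          rw [← ENNReal.ofReal_mul (by positivity)]; congr 1; ring
  · refine (hle.trans ?_).trans (ENNReal.ofReal_le_ofReal hA)
    refine lintegral_add_defect_le hθ1 (G := {g : MatVec d | ‖g.1‖ ≤ a})
      (hnorm measurableSet_Iic) ?_ (hφ0 _) (hφ1 _) (fun g => hone _) fun g hg => ?_
    · exact (ENNReal.ofReal_le_iff_le_toReal (measure_ne_top _ _)).1 hconc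
    · refine ENNReal.ofReal_le_ofReal ((hφd g).trans (hmono ?_))
      exact mul_le_mul_of_nonneg_right (Real.rpow_le_rpow (norm_nonneg _) hg hp.le) hsp
  · calc ∫⁻ z, ENNReal.ofReal (φ (dist z.1 z.2 ^ p)) ∂π ≤ ∫⁻ _, 1 ∂π :=
          lintegral_mono fun z => hone _
      _ ≤ ENNReal.ofReal A := by simpa using ENNReal.ofReal_le_ofReal hA

/-- A family of probability measures that is Hölder continuous in total variation is measurable. -/
lemma measurable_of_tvNorm_le {X Ω : Type*} [PseudoMetricSpace X] [MeasurableSpace X]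
    [OpensMeasurableSpace X] [MeasurableSpace Ω] {μ : X → Measure Ω}
    (hμ : ∀ x, IsProbabilityMeasure (μ x)) {l p : ℝ} (hp : 0 < p)
    (h : ∀ x y, tvNorm (μ x) (μ y) ≤ l * dist x y ^ p) : Measurable μ := by
  refine Measure.measurable_of_measurable_coe _ fun A hA => ?_
  have hreal : Continuous fun x => (μ x).real A := by
    refine continuous_iff_continuousAt.2 fun x => ?_
    rw [ContinuousAt, tendsto_iff_dist_tendsto_zero]
    have hlim : Tendsto (fun y => l * dist y x ^ p) (nhds x) (nhds 0) := by
      have h0 : Tendsto (fun y => dist y x) (nhds x) (nhds 0) := by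
        simpa using (continuous_id.dist continuous_const).tendsto (f := fun y => dist y x) x
      simpa [Real.zero_rpow hp.ne'] using (h0.rpow_const (Or.inr hp.le)).const_mul l
    refine squeeze_zero (fun _ => dist_nonneg) (fun y => ?_) hlim
    have h1 := (real_sub_le_tvNorm (μ y) (μ x) hA).trans (h y x)
    have h2 := (real_sub_le_tvNorm (μ x) (μ y) hA).trans (h x y)
    rw [dist_comm x y] at h2
    rw [Real.dist_eq, abs_le]
    constructor <;> linarith
  have e : (fun x => μ x A) = fun x => ENNReal.ofReal ((μ x).real A) :=
    funext fun x => (ofReal_measureReal (measure_ne_top _ _)).symm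
  rw [e]
  exact hreal.measurable.ennreal_ofReal

theorem perpetuities_place_dependent
    (d : ℕ)
    -- the family of measures μ_x on G
    (μm : Euc d → Measure (MatVec d))
    (hprob : ∀ x, IsProbabilityMeasure (μm x))
    -- α := sup_x ∫ ‖m‖ dμ_x < 1 and c := sup_x |q| dμ_x < ∞
    (α c : ℝ) (hα0 : 0 ≤ α) (hc0 : 0 ≤ c)
    (hαdef : (⨆ x : Euc d, ∫⁻ g : MatVec d, ENNReal.ofReal ‖g.1‖ ∂μm x) = ENNReal.ofReal α)
    (hα1 : α < 1)
    (hcdef : (⨆ x : Euc d, ∫⁻ g : MatVec d, ENNReal.ofReal ‖g.2‖ ∂μm x) = ENNReal.ofReal c)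
    -- Hölder continuity of x ↦ μ_x in the total variation norm
    (l nu : ℝ) (hl : 0 < l) (hnu : nu ∈ Set.Ioc (0:ℝ) 1)
    (hHolder : ∀ x y : Euc d, tvNorm (μm x) (μm y) ≤ l * dist x y ^ nu)
    -- (μ_x ∧ μ_y)({‖m‖ ≤ α}) > δ
    (δ : ℝ) (hδ : 0 < δ)
    (hconc : ∀ x y : Euc d,
      ENNReal.ofReal δ < (μm x ⊓ μm y) {g : MatVec d | ‖g.1‖ ≤ α}) :
    -- conclusion: a unique, exponentially attractive invariant measure μ* with finite
    -- first moment for Pf(x) = ∫_G f(mx+q) dμ_x(m,q)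
    ∃ μstar : Measure (Euc d), IsProbabilityMeasure μstar ∧
      (∫⁻ x, ENNReal.ofReal ‖x‖ ∂μstar < ⊤) ∧
      μstar.bind (fun x => (μm x).map (fun g : MatVec d => g.1 x + g.2)) = μstar ∧
      (∀ μ' : Measure (Euc d), IsProbabilityMeasure μ' →
        (∫⁻ x, ENNReal.ofReal ‖x‖ ∂μ' < ⊤) →
        μ'.bind (fun x => (μm x).map (fun g : MatVec d => g.1 x + g.2)) = μ' → μ' = μstar) ∧
      (∀ μ : Measure (Euc d), IsProbabilityMeasure μ →
        ∀ f : Euc d → ℝ, Continuous f → (∃ M, ∀ x, |f x| ≤ M) →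
        Tendsto
          (fun n => ∫ x,
            ((fun (g : Euc d → ℝ) x => ∫ w : MatVec d, g (w.1 x + w.2) ∂μm x)^[n] f) x ∂μ)
          atTop (nhds (∫ x, f x ∂μstar))) ∧
      ∃ q C : ℝ, q ∈ Set.Ioo (0:ℝ) 1 ∧ 0 < C ∧
        ∀ μ : Measure (Euc d), IsProbabilityMeasure μ →
          (∫⁻ x, ENNReal.ofReal ‖x‖ ∂μ < ⊤) → ∀ n : ℕ,
          fmDist
              ((fun m : Measure (Euc d) =>
                m.bind (fun x => (μm x).map (fun g : MatVec d => g.1 x + g.2)))^[n] μ)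
              μstar
            ≤ q ^ n * C * (1 + ∫ x, ‖x‖ ∂μ) := by
  have hmeas : ∀ w : Euc d, Measurable fun g : MatVec d => g.1 w + g.2 := fun w =>
    ((ContinuousLinearMap.measurable_apply w).comp measurable_fst).add measurable_snd
  have hαx : ∀ x, ∫⁻ g : MatVec d, ENNReal.ofReal ‖g.1‖ ∂μm x ≤ ENNReal.ofReal α := fun x =>
    hαdef ▸ le_iSup (fun x : Euc d => ∫⁻ g : MatVec d, ENNReal.ofReal ‖g.1‖ ∂μm x) x
  have hcx : ∀ x, ∫⁻ g : MatVec d, ENNReal.ofReal ‖g.2‖ ∂μm x ≤ ENNReal.ofReal c := fun x =>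
    hcdef ▸ le_iSup (fun x : Euc d => ∫⁻ g : MatVec d, ENNReal.ofReal ‖g.2‖ ∂μm x) x
  -- the transition kernel
  let km : Kernel (Euc d) (MatVec d) := ⟨μm, measurable_of_tvNorm_le hprob hnu.1 hHolder⟩
  have : IsMarkovKernel km := ⟨hprob⟩
  have hjoint : Measurable fun p : Euc d × MatVec d => p.2.1 p.1 + p.2.2 :=
    Continuous.measurable (by fun_prop)
  set κ : Kernel (Euc d) (Euc d) :=
    (Kernel.id ×ₖ km).map (fun p : Euc d × MatVec d => p.2.1 p.1 + p.2.2) with hκ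
  have : IsMarkovKernel κ := Kernel.IsMarkovKernel.map _ hjoint
  have hκx : ∀ x, κ x = (μm x).map (fun g : MatVec d => g.1 x + g.2) := fun x => by
    rw [hκ, Kernel.map_apply _ hjoint, Kernel.prod_apply, Kernel.id_apply, Measure.dirac_prod,
      Measure.map_map hjoint measurable_prodMk_left]
    rfl
  clear_value κ
  have hmom : ∀ x, ∫⁻ y, ENNReal.ofReal ‖y‖ ∂κ x ≤
      ENNReal.ofReal α * ENNReal.ofReal ‖x‖ + ENNReal.ofReal c := fun x => by
    rw [hκx, lintegral_map (by fun_prop) (hmeas x)]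
    calc ∫⁻ g : MatVec d, ENNReal.ofReal ‖g.1 x + g.2‖ ∂μm x
        ≤ ∫⁻ g : MatVec d, (ENNReal.ofReal ‖g.1‖ * ENNReal.ofReal ‖x‖ +
            ENNReal.ofReal ‖g.2‖) ∂μm x := by
          refine lintegral_mono fun g => ?_
          rw [← ENNReal.ofReal_mul (norm_nonneg _), ← ENNReal.ofReal_add (by positivity)
            (norm_nonneg _)]
          refine ENNReal.ofReal_le_ofReal ((norm_add_le _ _).trans ?_)
          gcongr
          exact g.1.le_opNorm x
      _ = (∫⁻ g : MatVec d, ENNReal.ofReal ‖g.1‖ ∂μm x) * ENNReal.ofReal ‖x‖ +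
            ∫⁻ g : MatVec d, ENNReal.ofReal ‖g.2‖ ∂μm x := by
          rw [lintegral_add_right _ (by fun_prop), lintegral_mul_const _ (by fun_prop)]
      _ ≤ _ := by gcongr; exacts [hαx x, hcx x]
  -- the distance-like function contracted by the kernel
  set a : ℝ := (1 + α) / 2 with ha
  have ha0 : 0 < a := by linarith
  have ha1 : a < 1 := by linarith
  have hαa : α ≤ a := by linarith
  have hR : 0 < 4 * c / (1 - α) + 1 := by
    have : 0 ≤ 4 * c / (1 - α) := div_nonneg (by linarith) (by linarith)
    linarith
  obtain ⟨φ, k, q₁, c₀, hmono, hφ0, hφ1, hc₀, hcφ, hk, hφk, hq₁0, hq₁1, hφS, hgauge⟩ :=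
    exists_contracting_gauge (a := a ^ nu) (δ := δ) (L := l)
      (S := (4 * c / (1 - α) + 1) ^ nu) (Real.rpow_pos_of_pos ha0 _)
      (Real.rpow_lt_one ha0.le ha1 hnu.1) hδ hl.le (Real.rpow_pos_of_pos hR _)
  obtain ⟨β, Q, hβ, hQ0, hQ1, hdrift⟩ := exists_drift_constants hq₁0 hq₁1 hα1 hc0
  have hpow : ∀ x y : Euc d, 0 ≤ dist x y ^ nu := fun x y => Real.rpow_nonneg dist_nonneg _
  have hφmin : ∀ x y : Euc d, c₀ * min 1 (dist x y) ≤ φ (dist x y ^ nu) := fun x y => by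
    refine le_trans (mul_le_mul_of_nonneg_left ?_ hc₀.le) (hcφ _ (hpow x y))
    rcases le_total 1 (dist x y) with h | h
    · exact le_min (min_le_left _ _) ((min_le_left _ _).trans (Real.one_le_rpow h hnu.1.le))
    · exact le_min (min_le_left _ _) ((min_le_right _ _).trans (by
        simpa using Real.rpow_le_rpow_of_exponent_ge' dist_nonneg h hnu.1.le hnu.2))
  have hW : ∀ x y : Euc d, 1 ≤ 1 + β * ‖x‖ + β * ‖y‖ := fun x y => by
    have : 0 ≤ β * ‖x‖ := by positivity
    have : 0 ≤ β * ‖y‖ := by positivity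
    linarith
  have hD : ∀ f : Euc d → ℝ, Measurable f → (∃ M, ∀ x, |f x| ≤ M) → ∀ K, 0 ≤ K →
      (∀ x y, |f x - f y| ≤ K * √(φ (dist x y ^ nu) * (1 + β * ‖x‖ + β * ‖y‖))) →
      ∀ x y, |markovOp κ f x - markovOp κ f y| ≤
        K * √Q * √(φ (dist x y ^ nu) * (1 + β * ‖x‖ + β * ‖y‖)) := by
    rintro f hf ⟨M, hM⟩ K hK hfK x y
    rcases eq_or_ne x y with rfl | hxy
    · rw [sub_self, abs_zero]; positivity
    have hs : 0 < dist x y ^ nu := Real.rpow_pos_of_pos (dist_pos.2 hxy) _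
    have hφpos : 0 < φ (dist x y ^ nu) :=
      lt_of_lt_of_le (mul_pos hc₀ (lt_min one_pos (dist_pos.2 hxy))) (hφmin x y)
    obtain ⟨π, hπ, h1, h2, h3⟩ := exists_affine_coupling hmono hφ0 hφ1 hk hφk ha0 hnu.1 hnu.2
      ((hαx x).trans (ENNReal.ofReal_le_ofReal hαa)) hl.le
      ((hconc x y).le.trans (measure_mono fun g (hg : ‖g.1‖ ≤ α) => hg.trans hαa)) x y
      (hHolder x y)
    rw [← hκx] at h1 h2
    have hmom' : ∀ x, ∫⁻ y, ENNReal.ofReal ‖y‖ ∂κ x ≤ ENNReal.ofReal (α * ‖x‖ + c) := fun x => by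
      rw [ENNReal.ofReal_add (by positivity) hc0, ENNReal.ofReal_mul hα0]
      exact hmom x
    obtain ⟨A, hA, hAle, hAQ⟩ : ∃ A, 0 < A ∧
        ∫⁻ z, ENNReal.ofReal (φ (dist z.1 z.2 ^ nu)) ∂π ≤ ENNReal.ofReal A ∧
        A * (1 + 2 * β * c + α * β * (‖x‖ + ‖y‖)) ≤
          Q * (φ (dist x y ^ nu) * (1 + β * (‖x‖ + ‖y‖))) := by
      rcases lt_or_ge (dist x y ^ nu) ((4 * c / (1 - α) + 1) ^ nu) with hlt | hge
      · refine ⟨q₁ * φ (dist x y ^ nu), by positivity,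
          h3 _ ((hgauge _ hs.le hlt).imp_right Or.inl), ?_⟩
        have := mul_le_mul_of_nonneg_left (hdrift (‖x‖ + ‖y‖) (by positivity)).1 hφpos.le
        linarith
      · refine ⟨1, one_pos, h3 _ (Or.inr (Or.inr le_rfl)), ?_⟩
        rw [hφS _ hge, one_mul, one_mul]
        refine (hdrift (‖x‖ + ‖y‖) (by positivity)).2 ?_
        refine ((Real.rpow_le_rpow_iff hR.le dist_nonneg hnu.1).1 hge).trans ?_
        exact dist_le_norm_add_norm x y
    have := abs_integral_map_fst_sub_map_snd_le (π := π)
      (Φ := fun z => φ (dist z.1 z.2 ^ nu)) (hmono.measurable.comp (by fun_prop))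
      (fun z => hφ0 _) hβ.le (u := α * ‖x‖ + c) (v := α * ‖y‖ + c) (by positivity)
      (by positivity) hA hK (h1 ▸ hmom' x) (h2 ▸ hmom' y) hAle hf hM hfK
    rw [h1, h2] at this
    refine this.trans ?_
    rw [mul_assoc, ← Real.sqrt_mul hQ0.le]
    refine mul_le_mul_of_nonneg_left (Real.sqrt_le_sqrt ?_) hK
    calc A * (1 + β * (α * ‖x‖ + c) + β * (α * ‖y‖ + c))
        = A * (1 + 2 * β * c + α * β * (‖x‖ + ‖y‖)) := by ring
      _ ≤ _ := hAQ
      _ = _ := by ring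
  obtain ⟨μs, hμs, hμs1, hinv, huniq, hattr, C, hC, hrate⟩ :=
    exists_invariant_of_contracting κ (q := √Q) (K₀ := 1 / √c₀) hα0 hα1 hc0
      (Real.sqrt_pos.2 hQ0) (by rw [Real.sqrt_lt' one_pos]; simpa using hQ1) hβ.le
      (by positivity) hmom
      (D := fun x y => √(φ (dist x y ^ nu) * (1 + β * ‖x‖ + β * ‖y‖))) hD
      (fun x y => by
        have h1 := hW x y
        refine Real.sqrt_le_iff.2 ⟨by linarith, ?_⟩
        nlinarith [hφ1 (dist x y ^ nu)])
      (fun x y => by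
        rw [one_div, ← div_eq_inv_mul, le_div_iff₀ (Real.sqrt_pos.2 hc₀)]
        refine Real.le_sqrt_of_sq_le ?_
        rw [mul_pow, Real.sq_sqrt hc₀.le]
        have h0 : 0 ≤ min 1 (dist x y) := le_min zero_le_one dist_nonneg
        calc min 1 (dist x y) ^ 2 * c₀ ≤ c₀ * min 1 (dist x y) := by
              nlinarith [min_le_left 1 (dist x y), mul_nonneg hc₀.le h0]
          _ ≤ φ (dist x y ^ nu) * 1 := by rw [mul_one]; exact hφmin x y
          _ ≤ _ := mul_le_mul_of_nonneg_left (hW x y) (hφ0 _))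
      (fun x => by
        have hlim : Tendsto (fun y => √(k * dist y x ^ nu * (1 + β * ‖y‖ + β * ‖x‖)))
            (nhds x) (nhds 0) := by
          have hcont : Continuous fun y : Euc d =>
              √(k * dist y x ^ nu * (1 + β * ‖y‖ + β * ‖x‖)) := by
            have : Continuous fun y : Euc d => dist y x ^ nu :=
              (continuous_id.dist continuous_const).rpow_const fun _ => Or.inr hnu.1.le
            fun_prop
          simpa [Real.zero_rpow hnu.1.ne'] using hcont.tendsto x
        refine squeeze_zero (fun y => Real.sqrt_nonneg _) (fun y => ?_) hlim
        have := hW y x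
        gcongr
        exact hφk _ (hpow y x))
  have hκfun : (fun x => (μm x).map (fun g : MatVec d => g.1 x + g.2)) = κ :=
    funext fun x => (hκx x).symm
  have hop : ∀ f : Euc d → ℝ, Measurable f → ∀ n,
      (fun (g : Euc d → ℝ) x => ∫ w : MatVec d, g (w.1 x + w.2) ∂μm x)^[n] f =
        (markovOp κ)^[n] f := fun f hf n => by
    induction n with
    | zero => rfl
    | succ n ih =>
      rw [Function.iterate_succ_apply', Function.iterate_succ_apply', ih]
      funext x
      rw [markovOp, hκx, integral_map (hmeas x).aemeasurable
        (hf.markovOp_iterate n).aestronglyMeasurable]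
  rw [hκfun]
  refine ⟨μs, hμs, hμs1, hinv, fun μ' h _ => huniq μ' h, fun μ hμ f hf hb => ?_, √Q, C,
    ⟨Real.sqrt_pos.2 hQ0, by rw [Real.sqrt_lt' one_pos]; simpa using hQ1⟩, hC, hrate⟩
  simpa only [hop f hf.measurable] using hattr μ hμ f hf hb

end
end

section
/- Let {P_x : x ∈ X} be a transition probability function on a Polish space X and {Q_{x,y} : x,y ∈ X} a measurable family of subprobability measures on X×X with Q_{x,y}(A×X) ≤ P_x(A) and Q_{x,y}(X×A) ≤ P_y(A) for all Borel A ⊂ X. Define R_{x,y} on rectangles by R_{x,y}(A×B) = (1 − Q_{x,y}(X²))^{-1}(P_x(A) − Q_{x,y}(A×X))(P_y(B) − Q_{x,y}(X×B)) when Q_{x,y}(X²) < 1 and R_{x,y} = 0 otherwise. Then the family B_{x,y} = Q_{x,y} + R_{x,y} is a coupling for {P_x : x ∈ X}: each B_{x,y} is a probability measure on X×X, (x,y) ↦ B_{x,y}(B) is measurable for every Borel B ⊂ X², and B_{x,y}(A×X) = P_x(A), B_{x,y}(X×A) = P_y(A) for all Borel A ⊂ X. -/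
open MeasureTheory ProbabilityTheory Set
open scoped ENNReal NNReal

noncomputable section

/-- The measures `R_{x,y}` built from the transition function `P` and the family `Q`. -/
def Rpart {X : Type*} [MeasurableSpace X] (P : Kernel X X) (Q : Kernel (X × X) (X × X))
    (z : X × X) : Measure (X × X) :=
  if Q z Set.univ < 1 then
    (1 - Q z Set.univ)⁻¹ • ((P z.1 - (Q z).fst).prod (P z.2 - (Q z).snd))
  else 0

/-- The coupling `B_{x,y} = Q_{x,y} + R_{x,y}`. -/
def Bpart {X : Type*} [MeasurableSpace X] (P : Kernel X X) (Q : Kernel (X × X) (X × X))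
    (z : X × X) : Measure (X × X) :=
  Q z + Rpart P Q z

section Coupling

variable {X : Type*} [MeasurableSpace X] {P : Kernel X X} {Q : Kernel (X × X) (X × X)}

lemma fst_sub_apply (hQsub : ∀ z, Q z univ ≤ 1) (hQfst : ∀ z, (Q z).fst ≤ P z.1) (z : X × X)
    {A : Set X} (hA : MeasurableSet A) :
    (P z.1 - (Q z).fst) A = P z.1 A - Q z (A ×ˢ univ) := by
  have : IsFiniteMeasure (Q z) := ⟨(hQsub z).trans_lt ENNReal.one_lt_top⟩
  rw [Measure.sub_apply hA (hQfst z), Measure.fst_apply hA, prod_univ]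

lemma snd_sub_apply (hQsub : ∀ z, Q z univ ≤ 1) (hQsnd : ∀ z, (Q z).snd ≤ P z.2) (z : X × X)
    {A : Set X} (hA : MeasurableSet A) :
    (P z.2 - (Q z).snd) A = P z.2 A - Q z (univ ×ˢ A) := by
  have : IsFiniteMeasure (Q z) := ⟨(hQsub z).trans_lt ENNReal.one_lt_top⟩
  rw [Measure.sub_apply hA (hQsnd z), Measure.snd_apply hA, univ_prod]

variable [IsMarkovKernel P]

lemma Rpart_apply_prod_of_lt (hQsub : ∀ z, Q z univ ≤ 1) (hQfst : ∀ z, (Q z).fst ≤ P z.1)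
    (hQsnd : ∀ z, (Q z).snd ≤ P z.2) {z : X × X} (hz : Q z univ < 1) {A B : Set X}
    (hA : MeasurableSet A) (hB : MeasurableSet B) :
    Rpart P Q z (A ×ˢ B) = (1 - Q z univ)⁻¹ *
      ((P z.1 A - Q z (A ×ˢ univ)) * (P z.2 B - Q z (univ ×ˢ B))) := by
  rw [Rpart, if_pos hz, Measure.smul_apply, Measure.prod_prod, fst_sub_apply hQsub hQfst z hA,
    snd_sub_apply hQsub hQsnd z hB, smul_eq_mul]

lemma measurable_Rpart (hQsub : ∀ z, Q z univ ≤ 1) (hQfst : ∀ z, (Q z).fst ≤ P z.1)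
    (hQsnd : ∀ z, (Q z).snd ≤ P z.2) : Measurable (Rpart P Q) := by
  have hrect {A B : Set X} (hA : MeasurableSet A) (hB : MeasurableSet B) :
      Measurable fun z : X × X ↦ (P z.1 - (Q z).fst).prod (P z.2 - (Q z).snd) (A ×ˢ B) := by
    simp only [Measure.prod_prod, fst_sub_apply hQsub hQfst _ hA, snd_sub_apply hQsub hQsnd _ hB]
    exact (((P.measurable_coe hA).comp measurable_fst).sub
        (Q.measurable_coe (hA.prod .univ))).mul
      (((P.measurable_coe hB).comp measurable_snd).sub (Q.measurable_coe (.prod .univ hB)))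
  have hprod : Measurable fun z : X × X ↦ (P z.1 - (Q z).fst).prod (P z.2 - (Q z).snd) := by
    refine .measure_of_isPiSystem generateFrom_prod.symm isPiSystem_prod ?_ ?_
    · rintro _ ⟨A, hA, B, hB, rfl⟩
      exact hrect hA hB
    · simpa only [univ_prod_univ] using hrect .univ .univ
  have hQuniv : Measurable fun z ↦ Q z univ := Q.measurable_coe .univ
  refine Measurable.ite (measurableSet_lt hQuniv measurable_const) ?_ measurable_const
  refine Measure.measurable_of_measurable_coe _ fun s hs ↦ ?_
  simp only [Measure.smul_apply, smul_eq_mul]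
  exact (measurable_const.sub hQuniv).inv.mul ((Measure.measurable_coe hs).comp hprod)

lemma Bpart_apply_prod_univ (hQsub : ∀ z, Q z univ ≤ 1) (hQfst : ∀ z, (Q z).fst ≤ P z.1)
    (hQsnd : ∀ z, (Q z).snd ≤ P z.2) (z : X × X) {A : Set X} (hA : MeasurableSet A) :
    Bpart P Q z (A ×ˢ univ) = P z.1 A := by
  have : IsFiniteMeasure (Q z) := ⟨(hQsub z).trans_lt ENNReal.one_lt_top⟩
  rw [Bpart, Measure.add_apply]
  rcases (hQsub z).lt_or_eq with hz | hz
  · have hle : Q z (A ×ˢ univ) ≤ P z.1 A := by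
      simpa only [Measure.fst_apply hA, prod_univ] using hQfst z A
    rw [Rpart_apply_prod_of_lt hQsub hQfst hQsnd hz hA .univ, univ_prod_univ,
      measure_univ (μ := P z.2),
      mul_comm, mul_assoc, ENNReal.mul_inv_cancel (tsub_pos_of_lt hz).ne'
        (ENNReal.sub_ne_top ENNReal.one_ne_top), mul_one, add_tsub_cancel_of_le hle]
  · have heq : (Q z).fst = P z.1 := Measure.eq_of_le_of_measure_univ_eq (hQfst z) <| by
      rw [Measure.fst_univ, hz, measure_univ]
    rw [Rpart, if_neg hz.not_lt, ← heq, Measure.fst_apply hA, prod_univ, Measure.coe_zero,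
      Pi.zero_apply, add_zero]

lemma Bpart_apply_univ_prod (hQsub : ∀ z, Q z univ ≤ 1) (hQfst : ∀ z, (Q z).fst ≤ P z.1)
    (hQsnd : ∀ z, (Q z).snd ≤ P z.2) (z : X × X) {A : Set X} (hA : MeasurableSet A) :
    Bpart P Q z (univ ×ˢ A) = P z.2 A := by
  have : IsFiniteMeasure (Q z) := ⟨(hQsub z).trans_lt ENNReal.one_lt_top⟩
  rw [Bpart, Measure.add_apply]
  rcases (hQsub z).lt_or_eq with hz | hz
  · have hle : Q z (univ ×ˢ A) ≤ P z.2 A := by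
      simpa only [Measure.snd_apply hA, univ_prod] using hQsnd z A
    rw [Rpart_apply_prod_of_lt hQsub hQfst hQsnd hz .univ hA, univ_prod_univ,
      measure_univ (μ := P z.1),
      ← mul_assoc, ENNReal.inv_mul_cancel (tsub_pos_of_lt hz).ne'
        (ENNReal.sub_ne_top ENNReal.one_ne_top), one_mul, add_tsub_cancel_of_le hle]
  · have heq : (Q z).snd = P z.2 := Measure.eq_of_le_of_measure_univ_eq (hQsnd z) <| by
      rw [Measure.snd_univ, hz, measure_univ]
    rw [Rpart, if_neg hz.not_lt, ← heq, Measure.snd_apply hA, univ_prod, Measure.coe_zero,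
      Pi.zero_apply, add_zero]

end Coupling

theorem coupling_construction
    {X : Type*} [MetricSpace X] [CompleteSpace X] [SecondCountableTopology X]
    [MeasurableSpace X] [BorelSpace X]
    -- the transition probability function
    (P : Kernel X X) [IsMarkovKernel P]
    -- the measurable family of subprobability measures Q_{x,y}
    (Q : Kernel (X × X) (X × X))
    (hQsub : ∀ z : X × X, Q z Set.univ ≤ 1)
    (hQfst : ∀ z : X × X, (Q z).fst ≤ P z.1)
    (hQsnd : ∀ z : X × X, (Q z).snd ≤ P z.2) :
    -- B_{x,y} = Q_{x,y} + R_{x,y} is a coupling for {P_x : x ∈ X}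
    (∀ z : X × X, IsProbabilityMeasure (Bpart P Q z)) ∧
    (∀ B : Set (X × X), MeasurableSet B → Measurable (fun z : X × X => Bpart P Q z B)) ∧
    (∀ z : X × X, ∀ A : Set X, MeasurableSet A →
      Bpart P Q z (A ×ˢ Set.univ) = P z.1 A ∧
      Bpart P Q z (Set.univ ×ˢ A) = P z.2 A) := by
  refine ⟨fun z ↦ ⟨?_⟩, fun B hB ↦ ?_, fun z A hA ↦
    ⟨Bpart_apply_prod_univ hQsub hQfst hQsnd z hA, Bpart_apply_univ_prod hQsub hQfst hQsnd z hA⟩⟩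
  · rw [← univ_prod_univ, Bpart_apply_prod_univ hQsub hQfst hQsnd z .univ, measure_univ]
  · exact (Q.measurable_coe hB).add
      ((Measure.measurable_coe hB).comp (measurable_Rpart hQsub hQfst hQsnd))

end
end

section
/- Suppose the family {Q_{x,y} : x,y ∈ X} satisfies: there exist F ⊂ X², α ∈ (0,1), l > 0 and ν ∈ (0,1] such that supp Q_{x,y} ⊂ F and ∫_{X²} d(u,v) Q_{x,y}(du,dv) ≤ α d(x,y) for (x,y) ∈ F, and 1 − Q_{x,y}(X²) ≤ l d(x,y)^ν for (x,y) ∈ F. Then for every finite Borel measure b on X² with supp b ⊂ F and every n ∈ ℕ, the iterated measure Q_b^n (defined by Q_b^0 = b and Q_b^{k+1} = Q_{Q_b^k}) satisfies Q_b^n(X²) ≥ b(X²) − (l/(1−α^ν)) ∫_{X²} d(u,v)^ν b(du,dv). -/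
open MeasureTheory ProbabilityTheory Set
open scoped ENNReal NNReal

noncomputable section

/-- The (topological) support of a measure. -/
def measSupport {X : Type*} [TopologicalSpace X] [MeasurableSpace X] (μ : Measure X) : Set X :=
  {x | ∀ U : Set X, IsOpen U → x ∈ U → 0 < μ U}

/-- Iterates `Q_b^n`: `Q_b^0 = b`, `Q_b^{k+1} = Q_{Q_b^k}`. -/
def QbIter {X : Type*} [MeasurableSpace X] (Q : Kernel (X × X) (X × X))
    (b : Measure (X × X)) : ℕ → Measure (X × X)
  | 0 => b
  | n + 1 => (QbIter Q b n).bind ⇑Q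

/-- In a second countable space, a measure is concentrated on any set containing its support. -/
theorem ae_mem_of_measSupport_subset {Y : Type*} [TopologicalSpace Y] [SecondCountableTopology Y]
    [MeasurableSpace Y] {μ : Measure Y} {F : Set Y} (h : measSupport μ ⊆ F) :
    ∀ᵐ y ∂μ, y ∈ F := by
  refine measure_null_of_locally_null _ fun y hy => ?_
  have hy' : y ∉ measSupport μ := fun h' => hy (h h')
  simp only [measSupport, mem_ofPred_eq, not_forall, not_lt, nonpos_iff_eq_zero] at hy'
  obtain ⟨U, hU, hyU, hμ⟩ := hy'
  exact ⟨U, mem_nhdsWithin_of_mem_nhds (hU.mem_nhds hyU), hμ⟩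

/-- Jensen's inequality for the concave power `t ↦ t ^ p` and a subprobability measure. -/
theorem lintegral_rpow_le_rpow_lintegral {Y : Type*} [MeasurableSpace Y] {μ : Measure Y}
    (hμ : μ univ ≤ 1) {f : Y → ℝ≥0∞} (hf : AEMeasurable f μ) {p : ℝ} (hp : 0 < p) (hp1 : p ≤ 1) :
    ∫⁻ y, f y ^ p ∂μ ≤ (∫⁻ y, f y ∂μ) ^ p := by
  have h := eLpNorm'_le_eLpNorm'_mul_rpow_measure_univ hp hp1 hf.aestronglyMeasurable
  simp only [eLpNorm', enorm_eq_self, ENNReal.rpow_one, div_one] at h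
  have h1 : μ univ ^ (1 / p - 1) ≤ 1 :=
    ENNReal.rpow_le_one hμ (sub_nonneg.2 ((one_le_div hp).2 hp1))
  have h2 : (∫⁻ y, f y ^ p ∂μ) ^ (1 / p) ≤ ∫⁻ y, f y ∂μ :=
    h.trans (mul_le_of_le_one_right' h1)
  rw [one_div] at h2
  exact (ENNReal.rpow_inv_le_iff hp).1 h2

theorem QbIter_bind {X : Type*} [MeasurableSpace X] (Q : Kernel (X × X) (X × X))
    (b : Measure (X × X)) (n : ℕ) : QbIter Q (b.bind Q) n = QbIter Q b (n + 1) := by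
  induction n with
  | zero => rfl
  | succ n ih =>
    change (QbIter Q (b.bind Q) n).bind Q = (QbIter Q b (n + 1)).bind Q
    rw [ih]

/-- If `V` is contracted by the factor `r` under `Q` and bounds the mass defect up to the factor
`l`, then the mass lost along the iterates is at most `C * ∫ V`, where `l + C * r = C`. -/
theorem measure_univ_le_QbIter_add {X : Type*} [MeasurableSpace X]
    (Q : Kernel (X × X) (X × X)) {V : X × X → ℝ≥0∞} (hV : Measurable V) {C l r : ℝ≥0∞}
    (hC : l + C * r = C) {G : Set (X × X)} (hG : MeasurableSet G)
    (hQG : ∀ z, ∀ᵐ w ∂Q z, w ∈ G) (hcontr : ∀ z ∈ G, ∫⁻ w, V w ∂Q z ≤ r * V z)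
    (hmass : ∀ z ∈ G, 1 ≤ Q z univ + l * V z) (n : ℕ) (b : Measure (X × X))
    (hb : ∀ᵐ z ∂b, z ∈ G) :
    b univ ≤ QbIter Q b n univ + C * ∫⁻ z, V z ∂b := by
  induction n generalizing b with
  | zero => exact le_self_add
  | succ n ih =>
    have hbG : ∀ᵐ z ∂(b.bind Q), z ∈ G := by
      rw [ae_iff, ← compl_def, Measure.bind_apply hG.compl Q.aemeasurable,
        lintegral_congr fun z => show Q z Gᶜ = 0 from hQG z, lintegral_zero]
    have h1 : ∫⁻ z, V z ∂(b.bind Q) ≤ r * ∫⁻ z, V z ∂b := by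
      rw [Measure.lintegral_bind Q.aemeasurable hV.aemeasurable, ← lintegral_const_mul r hV]
      exact lintegral_mono_ae (hb.mono hcontr)
    have h2 : b univ ≤ (b.bind Q) univ + l * ∫⁻ z, V z ∂b := by
      rw [Measure.bind_apply MeasurableSet.univ Q.aemeasurable, ← lintegral_const_mul l hV,
        ← lintegral_add_left (Q.measurable_coe MeasurableSet.univ), ← lintegral_one]
      exact lintegral_mono_ae (hb.mono hmass)
    calc b univ ≤ (b.bind Q) univ + l * ∫⁻ z, V z ∂b := h2
      _ ≤ (QbIter Q b (n + 1) univ + C * (r * ∫⁻ z, V z ∂b)) + l * ∫⁻ z, V z ∂b := by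
          gcongr
          refine (ih _ hbG).trans ?_
          rw [QbIter_bind]
          gcongr
      _ = QbIter Q b (n + 1) univ + (l + C * r) * ∫⁻ z, V z ∂b := by ring
      _ = QbIter Q b (n + 1) univ + C * ∫⁻ z, V z ∂b := by rw [hC]

theorem iterated_mass_loss_estimate
    {X : Type*} [MetricSpace X] [CompleteSpace X] [SecondCountableTopology X]
    [MeasurableSpace X] [BorelSpace X]
    -- the measurable family of subprobability measures Q_{x,y}
    (Q : Kernel (X × X) (X × X))
    (hQsub : ∀ z : X × X, Q z Set.univ ≤ 1)
    (F : Set (X × X)) (α l nu : ℝ) (hα : α ∈ Set.Ioo (0:ℝ) 1)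
    (hl : 0 < l) (hnu : nu ∈ Set.Ioc (0:ℝ) 1)
    (hsupp : ∀ z : X × X, measSupport (Q z) ⊆ F)
    (hcontr : ∀ z ∈ F, ∫⁻ w : X × X, ENNReal.ofReal (dist w.1 w.2) ∂Q z
        ≤ ENNReal.ofReal (α * dist z.1 z.2))
    (hmass : ∀ z ∈ F, 1 - (Q z Set.univ).toReal ≤ l * dist z.1 z.2 ^ nu)
    -- a finite measure b supported in F
    (b : Measure (X × X)) (hb : IsFiniteMeasure b) (hsuppb : measSupport b ⊆ F) :
    ∀ n : ℕ,
      b Set.univ -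
          ENNReal.ofReal (l / (1 - α ^ nu)) *
            ∫⁻ z : X × X, ENNReal.ofReal (dist z.1 z.2 ^ nu) ∂b
        ≤ QbIter Q b n Set.univ := by
  intro n
  obtain ⟨hα0, hα1⟩ := hα
  obtain ⟨hnu0, hnu1⟩ := hnu
  have hr0 : 0 < α ^ nu := Real.rpow_pos_of_pos hα0 nu
  have hr1 : 0 < 1 - α ^ nu := sub_pos.2 (Real.rpow_lt_one hα0.le hα1 hnu0)
  let V : X × X → ℝ≥0∞ := fun z => ENNReal.ofReal (dist z.1 z.2 ^ nu)
  have hVeq (z : X × X) : V z = ENNReal.ofReal (dist z.1 z.2) ^ nu :=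
    (ENNReal.ofReal_rpow_of_nonneg dist_nonneg hnu0.le).symm
  have hd : Measurable fun z : X × X => dist z.1 z.2 := measurable_dist
  have hV : Measurable V := (hd.pow_const nu).ennreal_ofReal
  have hC : ENNReal.ofReal l + ENNReal.ofReal (l / (1 - α ^ nu)) * ENNReal.ofReal (α ^ nu)
      = ENNReal.ofReal (l / (1 - α ^ nu)) := by
    rw [← ENNReal.ofReal_mul (by positivity), ← ENNReal.ofReal_add hl.le (by positivity)]
    congr 1
    field_simp
    ring
  -- `F` need not be measurable, so it is replaced by the measurable set where the estimates hold.
  let G : Set (X × X) := {z | ∫⁻ w, V w ∂Q z ≤ ENNReal.ofReal (α ^ nu) * V z} ∩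
    {z | 1 ≤ Q z univ + ENNReal.ofReal l * V z}
  have hG : MeasurableSet G :=
    (measurableSet_le hV.lintegral_kernel (hV.const_mul _)).inter
      (measurableSet_le measurable_const
        ((Q.measurable_coe MeasurableSet.univ).add (hV.const_mul _)))
  have hFG : F ⊆ G := by
    intro z hz
    constructor
    · calc ∫⁻ w, V w ∂Q z = ∫⁻ w, ENNReal.ofReal (dist w.1 w.2) ^ nu ∂Q z := by simp only [hVeq]
        _ ≤ (∫⁻ w, ENNReal.ofReal (dist w.1 w.2) ∂Q z) ^ nu :=
            lintegral_rpow_le_rpow_lintegral (hQsub z) hd.ennreal_ofReal.aemeasurable hnu0 hnu1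
        _ ≤ ENNReal.ofReal (α * dist z.1 z.2) ^ nu :=
            ENNReal.rpow_le_rpow (hcontr z hz) hnu0.le
        _ = ENNReal.ofReal (α ^ nu) * V z := by
            rw [hVeq, ENNReal.ofReal_mul hα0.le, ENNReal.mul_rpow_of_nonneg _ _ hnu0.le,
              ENNReal.ofReal_rpow_of_pos hα0]
    · have hfin : Q z univ ≠ ∞ := ((hQsub z).trans_lt ENNReal.one_lt_top).ne
      have hdn : 0 ≤ dist z.1 z.2 ^ nu := Real.rpow_nonneg dist_nonneg nu
      change 1 ≤ Q z univ + ENNReal.ofReal l * ENNReal.ofReal (dist z.1 z.2 ^ nu)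
      rw [← ENNReal.ofReal_mul hl.le, ← ENNReal.ofReal_toReal hfin,
        ← ENNReal.ofReal_add ENNReal.toReal_nonneg (by positivity), ← ENNReal.ofReal_one]
      exact ENNReal.ofReal_le_ofReal (by linarith [hmass z hz])
  exact tsub_le_iff_right.2 <| measure_univ_le_QbIter_add Q hV hC hG
    (fun z => (ae_mem_of_measSupport_subset (hsupp z)).mono hFG)
    (fun z hz => hz.1) (fun z hz => hz.2) n b
    ((ae_mem_of_measSupport_subset hsuppb).mono hFG)

end
end

section
/- For probability measures ϑ_x, ϑ_y, ϑ_{x'}, ϑ_{y'} on a measurable space (Θ,Ξ), one has ‖(ϑ_{x'} ∧ ϑ_{y'}) − (ϑ_x ∧ ϑ_y)‖ ≤ 2(‖ϑ_{x'} − ϑ_x‖ + ‖ϑ_{y'} − ϑ_y‖), where ‖·‖ is the total variation norm and ∧ the greatest lower bound in the lattice of finite measures. -/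
open MeasureTheory Set
open scoped ENNReal NNReal

noncomputable section

/-- The difference of two finite measures on a measurable set, through their truncated
differences. -/
lemma measureReal_sub_measureReal {Θ : Type*} [MeasurableSpace Θ] (μ ν : Measure Θ)
    [IsFiniteMeasure μ] [IsFiniteMeasure ν] {A : Set Θ} (hA : MeasurableSet A) :
    μ.real A - ν.real A = (μ - ν).real A - (ν - μ).real A := by
  have h := congrArg (fun v : SignedMeasure Θ => v A)
    (Measure.sub_toSignedMeasure_eq_toSignedMeasure_sub (μ := μ) (ν := ν))
  simpa [Measure.toSignedMeasure_apply_measurable hA] using h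

lemma measure_le_add_sub {Θ : Type*} [MeasurableSpace Θ] (μ ν : Measure Θ)
    [IsFiniteMeasure μ] [IsFiniteMeasure ν] : μ ≤ ν + (μ - ν) := by
  refine Measure.le_iff.2 fun A hA => ?_
  have h := measureReal_sub_measureReal μ ν hA
  have h0 : 0 ≤ (ν - μ).real A := measureReal_nonneg
  have h1 : μ.real A ≤ (ν + (μ - ν)).real A := by
    rw [measureReal_add_apply]
    linarith
  exact (ENNReal.toReal_le_toReal (measure_ne_top _ _) (measure_ne_top _ _)).1 h1

lemma inf_measureReal_le_add {Θ : Type*} [MeasurableSpace Θ] (μ ν μ' ν' : Measure Θ)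
    [IsFiniteMeasure μ] [IsFiniteMeasure ν] [IsFiniteMeasure μ'] [IsFiniteMeasure ν']
    {A : Set Θ} (hA : MeasurableSet A) :
    (μ' ⊓ ν').real A ≤ (μ ⊓ ν).real A + ((μ' - μ).real A + (ν' - ν).real A) := by
  have : IsFiniteMeasure (μ ⊓ ν) := isFiniteMeasure_of_le μ inf_le_left
  have key : (μ' ⊓ ν') A ≤ (μ ⊓ ν) A + ((μ' - μ) A + (ν' - ν) A) := by
    rw [← tsub_le_iff_right, Measure.inf_apply (μ := μ) hA]
    refine le_sInf ?_
    rintro _ ⟨t, rfl⟩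
    rw [tsub_le_iff_right, Measure.inf_apply hA]
    refine le_trans (sInf_le ⟨t, rfl⟩) ?_
    calc μ' (t ∩ A) + ν' (tᶜ ∩ A)
        ≤ (μ (t ∩ A) + (μ' - μ) (t ∩ A)) + (ν (tᶜ ∩ A) + (ν' - ν) (tᶜ ∩ A)) :=
          add_le_add (measure_le_add_sub μ' μ _) (measure_le_add_sub ν' ν _)
      _ ≤ (μ (t ∩ A) + (μ' - μ) A) + (ν (tᶜ ∩ A) + (ν' - ν) A) := by
          gcongr <;> exact inter_subset_right
      _ = μ (t ∩ A) + ν (tᶜ ∩ A) + ((μ' - μ) A + (ν' - ν) A) := add_add_add_comm _ _ _ _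
  have h := ENNReal.toReal_mono (by finiteness) key
  rwa [ENNReal.toReal_add (by finiteness) (by finiteness),
    ENNReal.toReal_add (by finiteness) (by finiteness)] at h

lemma sub_univ_add_sub_univ_le_tvNorm {Θ : Type*} [MeasurableSpace Θ] (μ ν : Measure Θ)
    [IsFiniteMeasure μ] [IsFiniteMeasure ν] :
    (μ - ν).real univ + (ν - μ).real univ ≤ tvNorm μ ν := by
  obtain ⟨s, hs⟩ := exists_isHahnDecomposition μ ν
  have hm := hs.measurableSet
  have h0 : (μ - ν).real s = 0 := by
    simp [measureReal_def, Measure.sub_apply_eq_zero_of_isHahnDecomposition hs]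
  have h1 : (ν - μ).real sᶜ = 0 := by
    simp [measureReal_def, Measure.sub_apply_eq_zero_of_isHahnDecomposition hs.compl]
  refine le_csSup ⟨μ.real univ + ν.real univ, ?_⟩ ⟨sᶜ, hm.compl, ?_⟩
  · rintro _ ⟨A, hA, rfl⟩
    simp only [← measureReal_def]
    have hμ := measureReal_add_measureReal_compl (μ := μ) hA
    have hν := measureReal_add_measureReal_compl (μ := ν) hA
    have : 0 ≤ μ.real Aᶜ := measureReal_nonneg
    have : 0 ≤ ν.real A := measureReal_nonneg
    linarith
  · simp only [← measureReal_def, compl_compl]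
    have hμ := measureReal_add_measureReal_compl (μ := μ - ν) hm
    have hν := measureReal_add_measureReal_compl (μ := ν - μ) hm
    have e := measureReal_sub_measureReal μ ν hm
    have e' := measureReal_sub_measureReal μ ν hm.compl
    linarith

lemma sub_add_sub_compl_le_tvNorm {Θ : Type*} [MeasurableSpace Θ] (μ ν : Measure Θ)
    [IsFiniteMeasure μ] [IsFiniteMeasure ν] (A : Set Θ) :
    (μ - ν).real A + (ν - μ).real Aᶜ ≤ tvNorm μ ν :=
  (add_le_add (measureReal_mono (subset_univ _)) (measureReal_mono (subset_univ _))).trans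
    (sub_univ_add_sub_univ_le_tvNorm μ ν)

theorem tv_of_inf_estimate
    {Θ : Type*} [MeasurableSpace Θ]
    (ϑx ϑy ϑx' ϑy' : Measure Θ)
    (hx : IsProbabilityMeasure ϑx) (hy : IsProbabilityMeasure ϑy)
    (hx' : IsProbabilityMeasure ϑx') (hy' : IsProbabilityMeasure ϑy') :
    tvNorm (ϑx' ⊓ ϑy') (ϑx ⊓ ϑy) ≤ 2 * (tvNorm ϑx' ϑx + tvNorm ϑy' ϑy) := by
  have h0 : 0 ≤ tvNorm ϑx' ϑx := (by positivity : (0 : ℝ) ≤ _).trans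
    (sub_univ_add_sub_univ_le_tvNorm ϑx' ϑx)
  have h1 : 0 ≤ tvNorm ϑy' ϑy := (by positivity : (0 : ℝ) ≤ _).trans
    (sub_univ_add_sub_univ_le_tvNorm ϑy' ϑy)
  refine csSup_le ⟨_, univ, MeasurableSet.univ, rfl⟩ ?_
  rintro _ ⟨A, hA, rfl⟩
  simp only [← measureReal_def]
  have hA₁ := inf_measureReal_le_add ϑx ϑy ϑx' ϑy' hA
  have hA₂ := inf_measureReal_le_add ϑx' ϑy' ϑx ϑy hA.compl
  have hx₁ := sub_add_sub_compl_le_tvNorm ϑx' ϑx A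
  have hy₁ := sub_add_sub_compl_le_tvNorm ϑy' ϑy A
  linarith

end
end

section
/- Suppose {ϑ_x : x ∈ X} is a family of probability measures on a measurable space (Θ,Ξ) satisfying ‖ϑ_x − ϑ_y‖ ≤ l d(x,y)^ν in total variation for some l > 0, ν ∈ (0,1] and all x,y ∈ X, and {S_θ : θ ∈ Θ} are continuous self-maps of X with (θ,x) ↦ S_θ(x) product measurable. Define Q_{x,y}(C) = ∫_Θ 1_C(S_θ(x),S_θ(y)) (ϑ_x ∧ ϑ_y)(dθ). Then the operator Q(f)(x,y) = ∫_Θ f(S_θ(x),S_θ(y)) (ϑ_x ∧ ϑ_y)(dθ) maps B_b(X²) into B_b(X²); in particular, for every Borel set C ⊂ X² the map (x,y) ↦ Q_{x,y}(C) is Borel measurable. -/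
open MeasureTheory ProbabilityTheory Set
open scoped ENNReal NNReal

noncomputable section

/-- The masses of a measurable set under two probability measures differ by at most their
total variation distance. -/
lemma measureReal_sub_le_tvNorm_of_measurableSet {Θ : Type*} [MeasurableSpace Θ] (μ ν : Measure Θ)
    [IsProbabilityMeasure μ] [IsProbabilityMeasure ν] {A : Set Θ} (hA : MeasurableSet A) :
    2 * (μ.real A - ν.real A) ≤ tvNorm μ ν := by
  refine le_csSup ⟨2, ?_⟩ ⟨A, hA, ?_⟩
  · rintro r ⟨B, -, rfl⟩
    have h₁ : μ.real B ≤ 1 := measureReal_le_one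
    have h₂ : ν.real Bᶜ ≤ 1 := measureReal_le_one
    have h₃ : 0 ≤ ν.real B := measureReal_nonneg
    have h₄ : 0 ≤ μ.real Bᶜ := measureReal_nonneg
    simp only [Measure.real] at *
    linarith
  · have h₁ := probReal_compl_eq_one_sub (μ := μ) hA
    have h₂ := probReal_compl_eq_one_sub (μ := ν) hA
    simp only [Measure.real] at *
    rw [h₁, h₂]
    ring

/-- The outer masses of an arbitrary set under two probability measures differ by at most their
total variation distance. -/
lemma measureReal_sub_le_tvNorm {Θ : Type*} [MeasurableSpace Θ] (μ ν : Measure Θ)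
    [IsProbabilityMeasure μ] [IsProbabilityMeasure ν] (T : Set Θ) :
    2 * (μ.real T - ν.real T) ≤ tvNorm μ ν := by
  have h₁ := measureReal_sub_le_tvNorm_of_measurableSet μ ν (measurableSet_toMeasurable ν T)
  have h₂ : μ.real T ≤ μ.real (toMeasurable ν T) := measureReal_mono (subset_toMeasurable ν T)
  have h₃ : ν.real (toMeasurable ν T) = ν.real T := by
    simp only [Measure.real, measure_toMeasurable]
  linarith

/-- If `x ↦ ϑ x` is Hölder continuous in total variation, then `x ↦ ϑ x T` is continuous for
every set `T`, measurable or not. -/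
lemma continuous_measure_of_tvNorm_le {X Θ : Type*} [PseudoMetricSpace X] [MeasurableSpace Θ]
    (ϑ : X → Measure Θ) [∀ x, IsProbabilityMeasure (ϑ x)] {l r : ℝ} (hr : 0 < r)
    (h : ∀ x y, tvNorm (ϑ x) (ϑ y) ≤ l * dist x y ^ r) (T : Set Θ) :
    Continuous fun x => ϑ x T := by
  have hreal : Continuous fun x => (ϑ x).real T := by
    refine continuous_iff_continuousAt.2 fun x₀ => tendsto_iff_dist_tendsto_zero.2 ?_
    have hlim : Continuous fun x => l * dist x x₀ ^ r / 2 :=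
      ((((continuous_id.dist continuous_const).rpow_const fun _ => Or.inr hr.le).const_mul
        l).div_const 2)
    have hlim₀ := hlim.tendsto x₀
    simp only [dist_self, Real.zero_rpow hr.ne', mul_zero, zero_div] at hlim₀
    refine squeeze_zero (fun _ => dist_nonneg) (fun x => ?_) hlim₀
    have h₁ := (measureReal_sub_le_tvNorm (ϑ x) (ϑ x₀) T).trans (h x x₀)
    have h₂ := (measureReal_sub_le_tvNorm (ϑ x₀) (ϑ x) T).trans (h x₀ x)
    rw [dist_comm x₀ x] at h₂
    rw [Real.dist_eq, abs_le]
    constructor <;> linarith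
  refine (ENNReal.continuous_ofReal.comp hreal).congr fun x => ?_
  exact ofReal_measureReal

/-- The infimum of two families of measures is measurable in the parameters as soon as both
families are continuous on every set. -/
lemma measurable_inf_of_continuous_measure {X Θ : Type*} [TopologicalSpace X]
    [MeasurableSpace X] [OpensMeasurableSpace X] [MeasurableSpace Θ] {μ ν : X → Measure Θ}
    (hμ : ∀ T, Continuous fun x => μ x T) (hν : ∀ T, Continuous fun x => ν x T) :
    Measurable fun x => μ x ⊓ ν x := by
  refine Measure.measurable_of_measurable_coe _ fun A hA => ?_
  have hinf (x : X) : (μ x ⊓ ν x) A = ⨅ t : Set Θ, (μ x (t ∩ A) + ν x (tᶜ ∩ A)) := by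
    rw [Measure.inf_apply hA, iInf]
    congr 1
    ext m
    simp [eq_comm]
  simp_rw [hinf]
  exact (upperSemicontinuous_iInf fun t =>
    ((hμ (t ∩ A)).add (hν (tᶜ ∩ A))).upperSemicontinuous).measurable

theorem measurability_of_Q
    {X : Type*} [MetricSpace X] [CompleteSpace X] [SecondCountableTopology X]
    [MeasurableSpace X] [BorelSpace X]
    {Θ : Type*} [MeasurableSpace Θ]
    (S : Θ → X → X) (hScont : ∀ θ, Continuous (S θ))
    (hSmeas : Measurable (Function.uncurry S))
    (ϑ : X → Measure Θ) (hϑ : ∀ x, IsProbabilityMeasure (ϑ x))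
    -- Hölder continuity of x ↦ ϑ_x in the total variation norm
    (l nu : ℝ) (hl : 0 < l) (hnu : nu ∈ Set.Ioc (0:ℝ) 1)
    (hHolder : ∀ x y : X, tvNorm (ϑ x) (ϑ y) ≤ l * dist x y ^ nu) :
    -- Q maps B_b(X²) into B_b(X²)
    (∀ f : X × X → ℝ, Measurable f → (∃ M, ∀ z, |f z| ≤ M) →
      Measurable (fun z : X × X => ∫ θ, f (S θ z.1, S θ z.2) ∂(ϑ z.1 ⊓ ϑ z.2)) ∧
      ∃ M', ∀ z : X × X, |∫ θ, f (S θ z.1, S θ z.2) ∂(ϑ z.1 ⊓ ϑ z.2)| ≤ M') ∧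
    -- in particular (x,y) ↦ Q_{x,y}(C) is Borel measurable for every Borel C
    (∀ C : Set (X × X), MeasurableSet C →
      Measurable (fun z : X × X =>
        ((ϑ z.1 ⊓ ϑ z.2).map (fun θ => (S θ z.1, S θ z.2))) C)) := by
  have hcont := continuous_measure_of_tvNorm_le ϑ hnu.1 hHolder
  let κ : Kernel (X × X) Θ := ⟨fun z => ϑ z.1 ⊓ ϑ z.2, measurable_inf_of_continuous_measure
    (fun T => (hcont T).comp continuous_fst) (fun T => (hcont T).comp continuous_snd)⟩
  have hle (z : X × X) : κ z univ ≤ 1 :=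
    ((inf_le_left : ϑ z.1 ⊓ ϑ z.2 ≤ ϑ z.1) univ).trans_eq measure_univ
  have : IsFiniteKernel κ := ⟨1, ENNReal.one_lt_top, hle⟩
  have hS : Measurable fun p : (X × X) × Θ => (S p.2 p.1.1, S p.2 p.1.2) :=
    (hSmeas.comp (measurable_snd.prodMk measurable_fst.fst)).prodMk
      (hSmeas.comp (measurable_snd.prodMk measurable_fst.snd))
  refine ⟨fun f hf ⟨M, hM⟩ => ⟨?_, |M|, fun z => ?_⟩, fun C hC => ?_⟩
  · exact (StronglyMeasurable.integral_kernel_prod_right' (κ := κ)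
      (hf.comp hS).stronglyMeasurable).measurable
  · have hint : ‖∫ θ, f (S θ z.1, S θ z.2) ∂κ z‖ ≤ |M| * (κ z).real univ :=
      norm_integral_le_of_norm_le_const (ae_of_all _ fun θ => (hM _).trans (le_abs_self M))
    exact hint.trans (mul_le_of_le_one_right (abs_nonneg M)
      (ENNReal.toReal_le_of_le_ofReal zero_le_one (by simpa using hle z)))
  · have hmap (z : X × X) : ((ϑ z.1 ⊓ ϑ z.2).map fun θ => (S θ z.1, S θ z.2)) C =
        κ z (Prod.mk z ⁻¹' ((fun p : (X × X) × Θ => (S p.2 p.1.1, S p.2 p.1.2)) ⁻¹' C)) :=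
      Measure.map_apply (hS.comp measurable_prodMk_left) hC
    simp_rw [hmap]
    exact Kernel.measurable_kernel_prodMk_left (hS hC)

end
end

section
/- Let (Y_n^y)_{n∈ℕ₀}, y ∈ Y, be a family of Markov chains on a metric space Y with common transition probability function {π_y : y ∈ Y}, and suppose V : Y → [0,∞) satisfies ∫_Y V(x) π_y(dx) ≤ aV(y) + b for all y ∈ Y, where a ∈ (0,1) and b > 0. Fix α ∈ ((1+a)/2, 1) and set V₀ = b/(α−a). Then for every y ∈ Y and every n ∈ ℕ, P(V(Y_0^y) > V₀, V(Y_1^y) > V₀, …, V(Y_n^y) > V₀) ≤ α^{n-1} V₀^{-1} (aV(y) + b). -/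
open MeasureTheory ProbabilityTheory Filter Set
open scoped ENNReal NNReal

noncomputable section

/-- Prepend a point to a path. -/
def prepend {Y : Type*} (y : Y) (ω : ℕ → Y) : ℕ → Y :=
  fun n => Nat.casesOn n y ω

/-- The paths along which `V` exceeds `c` up to time `n`. -/
def exceedSet {Y : Type*} (V : Y → ℝ) (c : ℝ) (n : ℕ) : Set (ℕ → Y) :=
  {ω | ∀ k : ℕ, k ≤ n → V (ω k) > c}

theorem measurableSet_exceedSet {Y : Type*} [MeasurableSpace Y] {V : Y → ℝ} (hV : Measurable V)
    (c : ℝ) (n : ℕ) : MeasurableSet (exceedSet V c n) := by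
  have h : exceedSet V c n = ⋂ k : ℕ, ⋂ _ : k ≤ n, {ω : ℕ → Y | V (ω k) > c} := by
    ext ω
    simp [exceedSet]
  rw [h]
  exact MeasurableSet.iInter fun k => MeasurableSet.iInter fun _ =>
    measurableSet_lt measurable_const (hV.comp (measurable_pi_apply k))

theorem measurable_prepend {Y : Type*} [MeasurableSpace Y] (y : Y) :
    Measurable (prepend y) := by
  refine measurable_pi_iff.2 fun n => ?_
  cases n with
  | zero => exact measurable_const
  | succ k => exact measurable_pi_apply k

theorem pathMeasure_exceedSet_succ_le {Y : Type*} [MeasurableSpace Y] (π : Kernel Y Y)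
    {Ppath : Y → Measure (ℕ → Y)} (hmeas : Measurable Ppath)
    (hrec : ∀ y, Ppath y = ((π y).bind Ppath).map (prepend y))
    {V : Y → ℝ} (hV : Measurable V) (c : ℝ) (n : ℕ) (y : Y) :
    Ppath y (exceedSet V c (n + 1)) ≤ ∫⁻ x, Ppath x (exceedSet V c n) ∂π y := by
  rw [hrec y, Measure.map_apply (measurable_prepend y) (measurableSet_exceedSet hV c _)]
  have hsub : prepend y ⁻¹' exceedSet V c (n + 1) ⊆ exceedSet V c n :=
    fun ω hω k hk => hω (k + 1) (by omega)
  refine (measure_mono hsub).trans_eq ?_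
  exact Measure.bind_apply (measurableSet_exceedSet hV c n) hmeas.aemeasurable

theorem pathMeasure_exceedSet_eq_zero {Y : Type*} [MeasurableSpace Y] (π : Kernel Y Y)
    {Ppath : Y → Measure (ℕ → Y)}
    (hrec : ∀ y, Ppath y = ((π y).bind Ppath).map (prepend y))
    {V : Y → ℝ} (hV : Measurable V) {c : ℝ} (n : ℕ) {y : Y} (hy : V y ≤ c) :
    Ppath y (exceedSet V c n) = 0 := by
  rw [hrec y, Measure.map_apply (measurable_prepend y) (measurableSet_exceedSet hV c _)]
  have hempty : prepend y ⁻¹' exceedSet V c n = ∅ :=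
    eq_empty_of_forall_notMem fun ω hω => (hω 0 (Nat.zero_le n)).not_ge hy
  rw [hempty, measure_empty]

/-- One step of the chain turns the bound `C * V` into the bound `C * (a * V + b)`. -/
theorem pathMeasure_exceedSet_succ_le_of_le {Y : Type*} [MeasurableSpace Y] (π : Kernel Y Y)
    {Ppath : Y → Measure (ℕ → Y)} (hmeas : Measurable Ppath)
    (hrec : ∀ y, Ppath y = ((π y).bind Ppath).map (prepend y))
    {V : Y → ℝ} (hV : Measurable V) {a b : ℝ}
    (hLyap : ∀ y, ∫⁻ x, ENNReal.ofReal (V x) ∂π y ≤ ENNReal.ofReal (a * V y + b))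
    {c C : ℝ} (hC : 0 ≤ C) {n : ℕ}
    (h : ∀ x, Ppath x (exceedSet V c n) ≤ ENNReal.ofReal (C * V x)) (y : Y) :
    Ppath y (exceedSet V c (n + 1)) ≤ ENNReal.ofReal (C * (a * V y + b)) := by
  calc Ppath y (exceedSet V c (n + 1))
      ≤ ∫⁻ x, Ppath x (exceedSet V c n) ∂π y :=
        pathMeasure_exceedSet_succ_le π hmeas hrec hV c n y
    _ ≤ ∫⁻ x, ENNReal.ofReal C * ENNReal.ofReal (V x) ∂π y :=
        lintegral_mono fun x => (h x).trans_eq (ENNReal.ofReal_mul hC)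
    _ = ENNReal.ofReal C * ∫⁻ x, ENNReal.ofReal (V x) ∂π y :=
        lintegral_const_mul _ hV.ennreal_ofReal
    _ ≤ ENNReal.ofReal C * ENNReal.ofReal (a * V y + b) := by gcongr; exact hLyap y
    _ = ENNReal.ofReal (C * (a * V y + b)) := (ENNReal.ofReal_mul hC).symm

theorem pathMeasure_exceedSet_le {Y : Type*} [MeasurableSpace Y] (π : Kernel Y Y)
    {Ppath : Y → Measure (ℕ → Y)} (hmeas : Measurable Ppath)
    (hprob : ∀ y, IsProbabilityMeasure (Ppath y))
    (hrec : ∀ y, Ppath y = ((π y).bind Ppath).map (prepend y))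
    {V : Y → ℝ} (hV : Measurable V) {a b : ℝ} (hb : 0 < b)
    (hLyap : ∀ y, ∫⁻ x, ENNReal.ofReal (V x) ∂π y ≤ ENNReal.ofReal (a * V y + b))
    {α : ℝ} (hα : 0 ≤ α) (haα : a < α) (n : ℕ) (y : Y) :
    Ppath y (exceedSet V (b / (α - a)) n) ≤
      ENNReal.ofReal (α ^ n * (b / (α - a))⁻¹ * V y) := by
  have hαa : 0 < α - a := sub_pos.2 haα
  have hc : 0 < b / (α - a) := div_pos hb hαa
  induction n generalizing y with
  | zero =>
    rcases le_or_gt (V y) (b / (α - a)) with hy | hy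
    · simp [pathMeasure_exceedSet_eq_zero π hrec hV 0 hy]
    · have := hprob y
      refine prob_le_one.trans ?_
      rw [ENNReal.one_le_ofReal, pow_zero, one_mul, ← div_eq_inv_mul, one_le_div hc]
      exact hy.le
  | succ n ih =>
    rcases le_or_gt (V y) (b / (α - a)) with hy | hy
    · simp [pathMeasure_exceedSet_eq_zero π hrec hV (n + 1) hy]
    · have hC : 0 ≤ α ^ n * (b / (α - a))⁻¹ := by positivity
      refine (pathMeasure_exceedSet_succ_le_of_le π hmeas hrec hV hLyap hC ih y).trans
        (ENNReal.ofReal_le_ofReal ?_)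
      have hdrift : a * V y + b ≤ α * V y := by
        have := (div_lt_iff₀ hαa).1 hy
        linarith
      calc α ^ n * (b / (α - a))⁻¹ * (a * V y + b)
          ≤ α ^ n * (b / (α - a))⁻¹ * (α * V y) := mul_le_mul_of_nonneg_left hdrift hC
        _ = α ^ (n + 1) * (b / (α - a))⁻¹ * V y := by ring

theorem chebyshev_estimate_for_chain
    {Y : Type*} [MetricSpace Y] [MeasurableSpace Y] [BorelSpace Y]
    -- the common transition probability function of the chains
    (π : Kernel Y Y) [IsMarkovKernel π]
    -- the pathspace measures ℙ_y of the chains started at y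
    (Ppath : Y → Measure (ℕ → Y)) (hmeas : Measurable Ppath)
    (hprob : ∀ y, IsProbabilityMeasure (Ppath y))
    (hrec : ∀ y, Ppath y = ((π y).bind Ppath).map (prepend y))
    -- V satisfies ∫ V dπ_y ≤ a V(y) + b
    (V : Y → ℝ) (hVmeas : Measurable V) (hVnonneg : ∀ y, 0 ≤ V y)
    (a b : ℝ) (ha : a ∈ Set.Ioo (0:ℝ) 1) (hb : 0 < b)
    (hLyap : ∀ y, ∫⁻ x, ENNReal.ofReal (V x) ∂π y ≤ ENNReal.ofReal (a * V y + b))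
    -- fix α ∈ ((1+a)/2, 1) and set V₀ = b/(α-a)
    (α : ℝ) (hα : α ∈ Set.Ioo ((1 + a) / 2) 1) :
    ∀ y : Y, ∀ n : ℕ, 1 ≤ n →
      Ppath y {ω : ℕ → Y | ∀ k : ℕ, k ≤ n → V (ω k) > b / (α - a)}
        ≤ ENNReal.ofReal (α ^ (n - 1) * (b / (α - a))⁻¹ * (a * V y + b)) := by
  have haα : a < α := by linarith [ha.2, hα.1]
  have hα0 : 0 ≤ α := (ha.1.trans haα).le
  have hc : 0 < b / (α - a) := div_pos hb (sub_pos.2 haα)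
  intro y n hn
  obtain ⟨m, rfl⟩ := Nat.exists_eq_add_of_le' hn
  exact pathMeasure_exceedSet_succ_le_of_le π hmeas hrec hVmeas hLyap (by positivity)
    (pathMeasure_exceedSet_le π hmeas hprob hrec hVmeas hb hLyap hα0 haα m) y

end
end

section
/- Suppose the Markov operator P with transition probability function {P_x : x ∈ X} and the family {Q_{x,y}} satisfy assumptions A0–A4, and let q ∈ (0,1), C₂ > 0 be such that ‖P^{*n}δ_x − P^{*n}δ_y‖_FM ≤ q^n C₂ (L(x)+L(y)+1) for all x,y ∈ X and n ∈ ℕ. Then there exists C₃ > 0 such that ‖P^{*n}δ_x − P^{*(n+k)}δ_x‖_FM ≤ q^n C₃ (1 + L(x)) for all x ∈ X and all n, k ∈ ℕ; in particular, (P^{*n}δ_x)_{n∈ℕ} is a Cauchy sequence in the Fortet–Mourier norm for every x ∈ X. -/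
open MeasureTheory ProbabilityTheory Filter Set
open scoped ENNReal NNReal

noncomputable section

/-- `geomInv t n = (t⁻¹)^n`, i.e. `t^{-n}`, with value `∞` at `n = ∞`. -/
def geomInv (t : ℝ) (n : ℕ∞) : ℝ≥0∞ :=
  if n = ⊤ then ⊤ else ENNReal.ofReal (t⁻¹ ^ n.toNat)

theorem fmDist_comm {X : Type*} [MetricSpace X] [MeasurableSpace X] (μ ν : Measure X) :
    fmDist μ ν = fmDist ν μ := by
  simp only [fmDist, abs_sub_comm]

theorem fmDist_le {X : Type*} [MetricSpace X] [MeasurableSpace X] {μ ν : Measure X} {a : ℝ}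
    (ha : 0 ≤ a)
    (h : ∀ f : X → ℝ, Continuous f → (∀ x, |f x| ≤ 1) → (∀ x y, |f x - f y| ≤ dist x y) →
      |∫ x, f x ∂μ - ∫ x, f x ∂ν| ≤ a) :
    fmDist μ ν ≤ a := by
  refine Real.sSup_le ?_ ha
  rintro r ⟨f, hf, hf1, hfL, rfl⟩
  exact h f hf hf1 hfL

theorem abs_integral_sub_le_fmDist {X : Type*} [MetricSpace X] [MeasurableSpace X]
    (μ ν : Measure X) [IsProbabilityMeasure μ] [IsProbabilityMeasure ν] {f : X → ℝ}
    (hf : Continuous f) (hf1 : ∀ x, |f x| ≤ 1) (hfL : ∀ x y, |f x - f y| ≤ dist x y) :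
    |∫ x, f x ∂μ - ∫ x, f x ∂ν| ≤ fmDist μ ν := by
  refine le_csSup ⟨2, ?_⟩ ⟨f, hf, hf1, hfL, rfl⟩
  rintro r ⟨g, -, hg1, -, rfl⟩
  have bound (ρ : Measure X) [IsProbabilityMeasure ρ] : |∫ x, g x ∂ρ| ≤ 1 := by
    simpa using norm_integral_le_of_norm_le_const (μ := ρ) (f := g) (C := 1) (ae_of_all _ hg1)
  linarith [abs_sub (∫ x, g x ∂μ) (∫ x, g x ∂ν), bound μ, bound ν]

/-- Convexity of the Fortet–Mourier distance: averaging a family of measures. -/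
theorem fmDist_bind_le {X : Type*} [MetricSpace X] [MeasurableSpace X] [BorelSpace X]
    (K : Kernel X X) [IsMarkovKernel K] (ρ μ : Measure X) [IsProbabilityMeasure ρ]
    [IsProbabilityMeasure μ] {g : X → ℝ} (hg : Integrable g μ)
    (h : ∀ y, fmDist ρ (K y) ≤ g y) :
    fmDist ρ (μ.bind K) ≤ ∫ y, g y ∂μ := by
  have hnonneg (y : X) : 0 ≤ g y :=
    ((abs_nonneg _).trans (abs_integral_sub_le_fmDist ρ (K y) (f := fun _ => 0)
      continuous_const (by simp) (by simp))).trans (h y)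
  refine fmDist_le (integral_nonneg hnonneg) fun f hf hf1 hfL => ?_
  have hfint (τ : Measure X) [IsProbabilityMeasure τ] : Integrable f τ :=
    .of_bound hf.measurable.aestronglyMeasurable 1 (ae_of_all _ hf1)
  have hfcomp : Integrable f ((K ∘ₖ Kernel.const Unit μ) ()) := hfint _
  have hKint : Integrable (fun y => ∫ z, f z ∂K y) μ := by
    simpa using hfcomp.integral_comp
  have hKeq : ∫ z, f z ∂(μ.bind K) = ∫ y, ∫ z, f z ∂K y ∂μ := by
    rw [Measure.comp_eq_comp_const_apply, Kernel.integral_comp hfcomp, Kernel.const_apply]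
  rw [hKeq]
  calc |∫ x, f x ∂ρ - ∫ y, ∫ z, f z ∂K y ∂μ|
      = ‖∫ y, (∫ x, f x ∂ρ - ∫ z, f z ∂K y) ∂μ‖ := by
        rw [integral_sub (integrable_const _) hKint]; simp
    _ ≤ ∫ y, g y ∂μ := norm_integral_le_of_norm_le hg <| ae_of_all _ fun y =>
        (abs_integral_sub_le_fmDist ρ (K y) hf hf1 hfL).trans (h y)

theorem exists_kernel_iterate_bind {X : Type*} [MeasurableSpace X] (P : Kernel X X)
    [IsMarkovKernel P] (n : ℕ) :
    ∃ K : Kernel X X, IsMarkovKernel K ∧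
      ∀ μ : Measure X, (fun m : Measure X => m.bind ⇑P)^[n] μ = μ.bind K := by
  induction n with
  | zero => exact ⟨Kernel.id, inferInstance, fun μ => Measure.id_comp.symm⟩
  | succ n ih =>
    obtain ⟨K, hK, h⟩ := ih
    refine ⟨P ∘ₖ K, inferInstance, fun μ => ?_⟩
    rw [Function.iterate_succ_apply', h]
    exact Measure.comp_assoc

/-- Propagation of a Lyapunov bound along the iterates. -/
theorem lintegral_iterate_bind_le {X : Type*} [MeasurableSpace X] (P : Kernel X X) {L : X → ℝ}
    (hL : Measurable L) (hLnonneg : ∀ x, 0 ≤ L x) {lam c : ℝ} (hlam : lam ∈ Set.Ioo (0 : ℝ) 1)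
    (hc : 0 ≤ c)
    (hLyap : ∀ x, ∫⁻ y, ENNReal.ofReal (L y) ∂P x ≤ ENNReal.ofReal (lam * L x + c))
    [IsMarkovKernel P] (x : X) (n : ℕ) :
    ∫⁻ y, ENNReal.ofReal (L y) ∂((fun m : Measure X => m.bind ⇑P)^[n] (Measure.dirac x))
      ≤ ENNReal.ofReal (L x + c / (1 - lam)) := by
  have hLx := hLnonneg x
  have hlam' : 0 < 1 - lam := by linarith [hlam.2]
  induction n with
  | zero =>
    rw [Function.iterate_zero_apply, lintegral_dirac' x (by fun_prop)]
    exact ENNReal.ofReal_le_ofReal (by have := div_nonneg hc hlam'.le; linarith)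
  | succ n ih =>
    obtain ⟨K, hK, hKeq⟩ := exists_kernel_iterate_bind P n
    rw [Function.iterate_succ_apply']
    set μ := (fun m : Measure X => m.bind ⇑P)^[n] (Measure.dirac x)
    have : IsProbabilityMeasure μ := by
      rw [show μ = K ∘ₘ Measure.dirac x from hKeq _]; infer_instance
    calc ∫⁻ y, ENNReal.ofReal (L y) ∂(μ.bind P)
        = ∫⁻ z, ∫⁻ y, ENNReal.ofReal (L y) ∂P z ∂μ :=
          Measure.lintegral_bind P.aemeasurable (by fun_prop)
      _ ≤ ∫⁻ z, (ENNReal.ofReal lam * ENNReal.ofReal (L z) + ENNReal.ofReal c) ∂μ := by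
          refine lintegral_mono fun z => (hLyap z).trans_eq ?_
          rw [ENNReal.ofReal_add (mul_nonneg hlam.1.le (hLnonneg z)) hc,
            ENNReal.ofReal_mul hlam.1.le]
      _ = ENNReal.ofReal lam * ∫⁻ z, ENNReal.ofReal (L z) ∂μ + ENNReal.ofReal c := by
          rw [lintegral_add_right _ measurable_const, lintegral_const_mul _ (by fun_prop)]
          simp
      _ ≤ ENNReal.ofReal lam * ENNReal.ofReal (L x + c / (1 - lam)) + ENNReal.ofReal c := by
          gcongr
      _ = ENNReal.ofReal (lam * (L x + c / (1 - lam)) + c) := by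
          rw [← ENNReal.ofReal_mul hlam.1.le, ← ENNReal.ofReal_add _ hc]
          have := div_nonneg hc hlam'.le
          exact mul_nonneg hlam.1.le (by linarith)
      _ ≤ ENNReal.ofReal (L x + c / (1 - lam)) := by
          refine ENNReal.ofReal_le_ofReal ?_
          have hd : c / (1 - lam) * (1 - lam) = c := div_mul_cancel₀ c hlam'.ne'
          nlinarith [mul_nonneg hLx hlam'.le]

theorem cauchy_sequence_of_iterates
    {X : Type*} [MetricSpace X] [CompleteSpace X] [SecondCountableTopology X]
    [MeasurableSpace X] [BorelSpace X]
    -- the Markov operator, given through its transition probability function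
    (P : Kernel X X) [IsMarkovKernel P]
    -- the family Q_{x,y} of subprobability measures with marginals dominated by P_x, P_y
    (Q : Kernel (X × X) (X × X))
    (hQsub : ∀ z : X × X, Q z Set.univ ≤ 1)
    (hQfst : ∀ z : X × X, (Q z).fst ≤ P z.1)
    (hQsnd : ∀ z : X × X, (Q z).snd ≤ P z.2)
    -- A0 : P is a Feller operator
    (hFeller : ∀ f : X → ℝ, Continuous f → (∃ M, ∀ x, |f x| ≤ M) →
      Continuous (fun x => ∫ y, f y ∂P x))
    -- A1 : there is a Lyapunov function L for P
    (L : X → ℝ) (hLcont : Continuous L) (hLnonneg : ∀ x, 0 ≤ L x)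
    (hLbdd : ∀ s : Set X, Bornology.IsBounded s → BddAbove (L '' s))
    (hLinf : Tendsto L (Bornology.cobounded X) atTop)
    (lam c : ℝ) (hlam : lam ∈ Set.Ioo (0:ℝ) 1) (hc : 0 < c)
    (hLyap : ∀ x, ∫⁻ y, ENNReal.ofReal (L y) ∂P x ≤ ENNReal.ofReal (lam * L x + c))
    -- A2 : contractivity of Q on F
    (F : Set (X × X)) (α : ℝ) (hα : α ∈ Set.Ioo (0:ℝ) 1)
    (hsupp : ∀ z : X × X, measSupport (Q z) ⊆ F)
    (hcontr : ∀ z ∈ F, ∫⁻ w : X × X, ENNReal.ofReal (dist w.1 w.2) ∂Q z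
        ≤ ENNReal.ofReal (α * dist z.1 z.2))
    -- A3 : mass of Q and concentration near the diagonal
    (δ l ν : ℝ) (hδ : 0 < δ) (hl : 0 < l) (hν : ν ∈ Set.Ioc (0:ℝ) 1)
    (hmass : ∀ z ∈ F, 1 - (Q z Set.univ).toReal ≤ l * dist z.1 z.2 ^ ν)
    (hconc : ∀ z ∈ F, ENNReal.ofReal δ ≤ Q z {w : X × X | dist w.1 w.2 < α * dist z.1 z.2})
    -- A4 : for the Markov chain on X² with transition function B_{x,y} = Q_{x,y} + R_{x,y},
    -- given by its pathspace measures `Bpath`, the hitting time κ of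
    -- {(x,y) ∈ F : L x + L y < R} has exponential moments
    (Bpath : X × X → Measure (ℕ → X × X))
    (hBmeas : Measurable Bpath)
    (hBprob : ∀ z, IsProbabilityMeasure (Bpath z))
    (hBrec : ∀ z, Bpath z = ((Bpart P Q z).bind Bpath).map (prepend z))
    (β Ctil R : ℝ) (hβ : β ∈ Set.Ioo (0:ℝ) 1) (hCtil : 0 < Ctil) (hR : 0 < R)
    (hA4 : ∀ z : X × X, L z.1 + L z.2 < 4 * c / (1 - lam) →
      ∫⁻ ω, geomInv β
          (⨅ n ∈ {n : ℕ | ω n ∈ F ∧ L (ω n).1 + L (ω n).2 < R}, (n : ℕ∞)) ∂(Bpath z)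
        ≤ ENNReal.ofReal Ctil)
    -- the already established pointwise exponential rate
    (q C₂ : ℝ) (hq : q ∈ Set.Ioo (0:ℝ) 1) (hC₂ : 0 < C₂)
    (hrate : ∀ x y : X, ∀ n : ℕ,
      fmDist ((fun m : Measure X => m.bind ⇑P)^[n] (Measure.dirac x))
          ((fun m : Measure X => m.bind ⇑P)^[n] (Measure.dirac y))
        ≤ q ^ n * C₂ * (L x + L y + 1)) :
    -- conclusion
    ∃ C₃ : ℝ, 0 < C₃ ∧
      (∀ x : X, ∀ n k : ℕ,
        fmDist ((fun m : Measure X => m.bind ⇑P)^[n] (Measure.dirac x))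
            ((fun m : Measure X => m.bind ⇑P)^[n + k] (Measure.dirac x))
          ≤ q ^ n * C₃ * (1 + L x)) ∧
      (∀ x : X, ∀ ε : ℝ, 0 < ε → ∃ N : ℕ, ∀ m ≥ N, ∀ n ≥ N,
        fmDist ((fun m' : Measure X => m'.bind ⇑P)^[m] (Measure.dirac x))
            ((fun m' : Measure X => m'.bind ⇑P)^[n] (Measure.dirac x)) < ε) := by
  set T : Measure X → Measure X := fun m : Measure X => m.bind ⇑P
  have hD : 0 ≤ c / (1 - lam) := div_nonneg hc.le (by linarith [hlam.2])
  set C₃ : ℝ := C₂ * (2 + c / (1 - lam)) with hC₃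
  have hC₃pos : 0 < C₃ := mul_pos hC₂ (by linarith)
  have hbound (x : X) (n k : ℕ) :
      fmDist (T^[n] (Measure.dirac x)) (T^[n + k] (Measure.dirac x))
        ≤ q ^ n * C₃ * (1 + L x) := by
    obtain ⟨K, hK, hKeq⟩ := exists_kernel_iterate_bind P n
    obtain ⟨K', hK', hKeq'⟩ := exists_kernel_iterate_bind P k
    have hprob : IsProbabilityMeasure (T^[k] (Measure.dirac x)) := by
      rw [show T^[k] (Measure.dirac x) = K' ∘ₘ Measure.dirac x from hKeq' _]; infer_instance
    have hdirac (y : X) : T^[n] (Measure.dirac y) = K y :=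
      (hKeq _).trans (Measure.dirac_bind K.measurable y)
    have hlint := lintegral_iterate_bind_le P hLcont.measurable hLnonneg hlam hc.le hLyap x k
    have hLint : Integrable L (T^[k] (Measure.dirac x)) :=
      (lintegral_ofReal_ne_top_iff_integrable hLcont.measurable.aestronglyMeasurable
        (ae_of_all _ hLnonneg)).1 (ne_top_of_le_ne_top ENNReal.ofReal_ne_top hlint)
    have hLle : ∫ y, L y ∂(T^[k] (Measure.dirac x)) ≤ L x + c / (1 - lam) := by
      rw [integral_eq_lintegral_of_nonneg_ae (ae_of_all _ hLnonneg) hLint.1]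
      exact ENNReal.toReal_le_of_le_ofReal (add_nonneg (hLnonneg x) hD) hlint
    rw [Function.iterate_add_apply, show T^[n] (T^[k] (Measure.dirac x)) = _ from hKeq _, hdirac]
    calc fmDist (K x) ((T^[k] (Measure.dirac x)).bind K)
        ≤ ∫ y, q ^ n * C₂ * (L y + (L x + 1)) ∂(T^[k] (Measure.dirac x)) := by
          refine fmDist_bind_le K _ _ ((hLint.add (integrable_const _)).const_mul _) fun y => ?_
          rw [← hdirac, ← hdirac]
          exact (hrate x y n).trans_eq (by ring)
      _ = q ^ n * C₂ * (∫ y, L y ∂(T^[k] (Measure.dirac x)) + (L x + 1)) := by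
          rw [integral_const_mul, integral_add hLint (integrable_const _)]
          simp
      _ ≤ q ^ n * C₂ * ((2 + c / (1 - lam)) * (1 + L x)) := by
          have := hq.1
          gcongr
          nlinarith [mul_nonneg hD (hLnonneg x), hLnonneg x]
      _ = q ^ n * C₃ * (1 + L x) := by rw [hC₃]; ring
  refine ⟨C₃, hC₃pos, hbound, fun x ε hε => ?_⟩
  have hlim : Tendsto (fun n : ℕ => q ^ n * C₃ * (1 + L x)) atTop (nhds 0) := by
    simpa using ((tendsto_pow_atTop_nhds_zero_of_lt_one hq.1.le hq.2).mul_const C₃).mul_const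
      (1 + L x)
  obtain ⟨N, hN⟩ := eventually_atTop.1 (hlim.eventually_lt_const hε)
  have hle (m n : ℕ) (hm : N ≤ m) (hmn : m ≤ n) :
      fmDist (T^[m] (Measure.dirac x)) (T^[n] (Measure.dirac x)) < ε := by
    obtain ⟨k, rfl⟩ := Nat.exists_eq_add_of_le hmn
    exact (hbound x m k).trans_lt (hN m hm)
  refine ⟨N, fun m hm n hn => ?_⟩
  rcases le_total m n with h | h
  · exact hle m n hm h
  · rw [fmDist_comm]; exact hle n m hn h
end
end
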